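/- Under the stated hypotheses, the Orbit 2 (K,L,L) three-term relation holds: S(g)·A(1+a−f, 1+b−f, 1+c−f, 1+d−f)·A(1−a, e−a, f−a, g−a)·K(a;b,c,d;e,f,g) + S(f−a)·A(a,b,c,d)·A(g−a, g−b, g−c, g−d)·L(1−a, 1−b, 1−c, 1−d; 2−e; 2−f, 2−g) − B_4(a,b,c,d,e,f,g)·L(a,b,c,d;f;e,g) = 0. -/

import Mathlib

noncomputable section

open Complex

/-- `Sn x = sin (π x)`. -/
def Sn (x : ℂ) : ℂ := Complex.sin ((Real.pi : ℂ) * x)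

/-- The renormalized Saalschützian series
`F*(a,b,c,d;e,f,g) = ∑ₖ Γ(k+a)Γ(k+b)Γ(k+c)Γ(k+d)/(k!·Γ(k+e)Γ(k+f)Γ(k+g))`. -/
def Fstar (a b c d e f g : ℂ) : ℂ :=
  ∑' k : ℕ, (Complex.Gamma (k + a) * Complex.Gamma (k + b) *
      Complex.Gamma (k + c) * Complex.Gamma (k + d)) /
    ((k.factorial : ℂ) * Complex.Gamma (k + e) * Complex.Gamma (k + f) *
      Complex.Gamma (k + g))

/-- The function `K(a;b,c,d;e,f,g)`. -/
def Kf (a b c d e f g : ℂ) : ℂ :=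
  (Fstar a b c d e f g +
      Fstar a (1 + a - e) (1 + a - f) (1 + a - g) (1 + a - b) (1 + a - c) (1 + a - d)) /
    (Sn a * Complex.Gamma a ^ 2 * Complex.Gamma b * Complex.Gamma c * Complex.Gamma d *
      Complex.Gamma (1 + a - e) * Complex.Gamma (1 + a - f) * Complex.Gamma (1 + a - g))

/-- The function `L(a,b,c,d;e;f,g)`. -/
def Lf (a b c d e f g : ℂ) : ℂ :=
  (Fstar a b c d e f g -
      Fstar (1 + a - e) (1 + b - e) (1 + c - e) (1 + d - e) (2 - e) (1 + f - e) (1 + g - e)) /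
    (Sn e * Complex.Gamma a * Complex.Gamma b * Complex.Gamma c * Complex.Gamma d *
      Complex.Gamma (1 + a - e) * Complex.Gamma (1 + b - e) * Complex.Gamma (1 + c - e) *
      Complex.Gamma (1 + d - e))

/-- `A(x,y,z,t) = 1/(Γ(x)Γ(y)Γ(z)Γ(t))`. -/
def Af (x y z t : ℂ) : ℂ :=
  1 / (Complex.Gamma x * Complex.Gamma y * Complex.Gamma z * Complex.Gamma t)

def B1 (a b c d e f g : ℂ) : ℂ :=
  Sn b * Sn c * (Sn (b - a) * Sn (c - a) * Sn d + Sn (e - a) * Sn (f - a) * Sn (g - a)) /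
    (Real.pi : ℂ) ^ 4

def B2 (a b c d e f g : ℂ) : ℂ :=
  Sn (f - a) * Sn (g - a) *
    (Sn (b - a) * Sn (c - a) * Sn (d - a) + Sn (e - 2 * a) * Sn (f - a) * Sn (g - a)) /
    (Real.pi : ℂ) ^ 4

def B3 (a b c d e f g : ℂ) : ℂ :=
  (Sn f * Sn (f - e) * Sn (g - a) * Sn (g - b) * Sn (g - c) * Sn (g - d) -
      Sn g * Sn (g - e) * Sn (f - a) * Sn (f - b) * Sn (f - c) * Sn (f - d)) /
    ((Real.pi : ℂ) ^ 4 * Sn (f - g))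

def B4 (a b c d e f g : ℂ) : ℂ :=
  Sn (f - a) * Sn (g - a) * (Sn b * Sn c * Sn d + Sn (e - a) * Sn f * Sn g) /
    (Real.pi : ℂ) ^ 4

def B5 (a b c d e f g : ℂ) : ℂ :=
  Sn b * Sn (e - b) *
    (Sn (b - a) * Sn (c - a) * Sn (d - a) + Sn (e - 2 * a) * Sn (f - a) * Sn (g - a)) /
    (Real.pi : ℂ) ^ 4

def Cf (a b c d e f g : ℂ) : ℂ :=
  Sn (e - a) * (Sn b * Sn c * Sn d * B2 a b c d e f g +
      Sn e * Sn (f - a) * Sn (g - a) * B4 a b c d e f g) / (Real.pi : ℂ) ^ 4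

open Filter Topology

theorem Gamma_add_nat_succ {x : ℝ} (hx : 0 < x) (n : ℕ) :
    Real.Gamma (x + (n + 1 : ℕ)) = (x + n) * Real.Gamma (x + n) := by
  have h : x + n ≠ 0 := by positivity
  rw [← Real.Gamma_add_one h]; congr 1; push_cast; ring

theorem Gamma_add_nat_eq_prod {x : ℝ} (hx : 0 < x) (n : ℕ) :
    Real.Gamma (x + n) = Real.Gamma x * ∏ j ∈ Finset.range n, (x + j) := by
  induction n with
  | zero => simp
  | succ n ih => rw [Gamma_add_nat_succ hx, ih, Finset.prod_range_succ]; ring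

theorem Gamma_one_add_nat (n : ℕ) : Real.Gamma (1 + n) = n.factorial := by
  rw [add_comm, Real.Gamma_nat_eq_factorial]

theorem Gamma_add_nat_pos {x : ℝ} (hx : 0 < x) (n : ℕ) : 0 < Real.Gamma (x + n) :=
  Real.Gamma_pos_of_pos (by positivity)

theorem tendsto_Gamma_add_nat {x : ℝ} (hx : 0 < x) :
    Tendsto (fun n : ℕ => Real.Gamma (x + 1 + n) / ((n : ℝ) ^ x * n.factorial)) atTop (𝓝 1) := by
  have hG : Real.Gamma x ≠ 0 := (Real.Gamma_pos_of_pos hx).ne'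
  have h := (tendsto_const_nhds (x := Real.Gamma x)).div (Real.GammaSeq_tendsto_Gamma x) hG
  rw [div_self hG] at h
  refine h.congr fun n => ?_
  have h1 : x + 1 + n = x + (n + 1 : ℕ) := by push_cast; ring
  rw [h1, Gamma_add_nat_eq_prod hx, Pi.div_apply, Real.GammaSeq, div_div_eq_mul_div]

theorem tendsto_Gamma_ratio {x y : ℝ} (hx : 0 < x) (hy : 0 < y) :
    Tendsto (fun n : ℕ => Real.Gamma (x + n) / Real.Gamma (y + n) * ((n : ℝ) + 1) ^ (y - x))
      atTop (𝓝 1) := by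
  have h1 := (tendsto_Gamma_add_nat hx).div (tendsto_Gamma_add_nat hy) one_ne_zero
  have hy' : Tendsto (fun n : ℕ => (y + n) / ((x : ℝ) + n)) atTop (𝓝 1) := by
    have := (tendsto_const_nhds (x := (1 : ℝ))).add
      ((tendsto_const_nhds (x := y - x)).div_atTop
        (tendsto_atTop_add_const_left atTop x tendsto_natCast_atTop_atTop))
    rw [add_zero] at this
    refine this.congr fun n => ?_
    have : x + n ≠ 0 := by positivity
    field_simp; ring
  have h2 : Tendsto (fun n : ℕ => (((n : ℝ) + 1) / n) ^ (y - x)) atTop (𝓝 1) := by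
    have h : Tendsto (fun n : ℕ => ((n : ℝ) + 1) / n) atTop (𝓝 1) := by
      have := (tendsto_const_nhds (x := (1 : ℝ))).add
        (tendsto_inv_atTop_nhds_zero_nat (𝕜 := ℝ))
      rw [add_zero] at this
      refine this.congr' ?_
      filter_upwards [eventually_gt_atTop 0] with n hn
      have : (n : ℝ) ≠ 0 := by positivity
      field_simp
    simpa using h.rpow_const (p := y - x) (Or.inl one_ne_zero)
  have h3 := (h1.mul hy').mul h2
  simp only [div_one, mul_one] at h3
  refine h3.congr' ?_
  filter_upwards [eventually_gt_atTop 0] with n hn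
  have hn' : (0 : ℝ) < n := by positivity
  have e1 : Real.Gamma (x + 1 + n) = (x + n) * Real.Gamma (x + n) := by
    rw [← Gamma_add_nat_succ hx]; congr 1; push_cast; ring
  have e2 : Real.Gamma (y + 1 + n) = (y + n) * Real.Gamma (y + n) := by
    rw [← Gamma_add_nat_succ hy]; congr 1; push_cast; ring
  have := Gamma_add_nat_pos hx n
  have := Gamma_add_nat_pos hy n
  have hxn : 0 < x + n := by positivity
  have hyn : 0 < y + n := by positivity
  have hf : (0 : ℝ) < n.factorial := by positivity
  simp only [Pi.div_apply]
  rw [Real.div_rpow (by positivity) (by positivity), Real.rpow_sub hn', e1, e2]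
  have := Real.rpow_pos_of_pos hn' x
  have := Real.rpow_pos_of_pos hn' y
  field_simp

theorem exists_Gamma_ratio_le {x y : ℝ} (hx : 0 < x) (hy : 0 < y) :
    ∃ C : ℝ, 0 ≤ C ∧ ∀ n : ℕ,
      Real.Gamma (x + n) / Real.Gamma (y + n) ≤ C * ((n : ℝ) + 1) ^ (x - y) := by
  obtain ⟨C, hC⟩ := (tendsto_Gamma_ratio hx hy).bddAbove_range
  have h : ∀ n : ℕ, Real.Gamma (x + n) / Real.Gamma (y + n) * ((n : ℝ) + 1) ^ (y - x) ≤ C :=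
    fun n => hC ⟨n, rfl⟩
  have hpos : ∀ n : ℕ, (0 : ℝ) < (n : ℝ) + 1 := fun n => by positivity
  refine ⟨C, le_trans ?_ (h 0), fun n => ?_⟩
  · have := Gamma_add_nat_pos hx 0
    have := Gamma_add_nat_pos hy 0
    have := hpos 0
    positivity
  · have h1 := mul_le_mul_of_nonneg_right (h n) (Real.rpow_nonneg (hpos n).le (x - y))
    rwa [mul_assoc, ← Real.rpow_add (hpos n), sub_add_sub_cancel, sub_self, Real.rpow_zero,
      mul_one] at h1

theorem summable_add_one_rpow {s : ℝ} (hs : s < -1) :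
    Summable fun n : ℕ => ((n : ℝ) + 1) ^ s := by
  have := (summable_nat_add_iff 1).mpr (Real.summable_nat_rpow.mpr hs)
  simpa using this

theorem tendsto_add_one_rpow {s : ℝ} (hs : s < 0) :
    Tendsto (fun n : ℕ => ((n : ℝ) + 1) ^ s) atTop (𝓝 0) := by
  have h := (tendsto_rpow_neg_atTop (y := -s) (by linarith)).comp
    (tendsto_atTop_add_const_right atTop (1 : ℝ) tendsto_natCast_atTop_atTop)
  simpa [Function.comp_def] using h

theorem exists_Gamma_ratio_two_le {a b x y : ℝ} (ha : 0 < a) (hb : 0 < b) (hx : 0 < x)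
    (hy : 0 < y) : ∃ C : ℝ, 0 ≤ C ∧ ∀ n : ℕ,
      Real.Gamma (a + n) * Real.Gamma (b + n) / (Real.Gamma (x + n) * Real.Gamma (y + n)) ≤
        C * ((n : ℝ) + 1) ^ (a + b - x - y) := by
  obtain ⟨C, hC, h⟩ := exists_Gamma_ratio_le ha hx
  obtain ⟨C', hC', h'⟩ := exists_Gamma_ratio_le hb hy
  refine ⟨C * C', by positivity, fun n => ?_⟩
  have hpos : (0 : ℝ) < (n : ℝ) + 1 := by positivity
  rw [mul_div_mul_comm, show a + b - x - y = (a - x) + (b - y) by ring, Real.rpow_add hpos,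
    mul_mul_mul_comm]
  exact mul_le_mul (h n) (h' n) (div_nonneg (Gamma_add_nat_pos hb n).le
    (Gamma_add_nat_pos hy n).le) (mul_nonneg hC (Real.rpow_nonneg hpos.le _))

/-- The `n`-th term of the (Gamma-normalised) Gauss series. -/
def gaussTerm (a b C : ℝ) (n : ℕ) : ℝ :=
  Real.Gamma (a + n) * Real.Gamma (b + n) / (Real.Gamma (1 + n) * Real.Gamma (C + n))

theorem gaussTerm_nonneg {a b C : ℝ} (ha : 0 < a) (hb : 0 < b) (hC : 0 < C) (n : ℕ) :
    0 ≤ gaussTerm a b C n := by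
  have := Gamma_add_nat_pos ha n
  have := Gamma_add_nat_pos hb n
  have := Gamma_add_nat_pos hC n
  have := Gamma_add_nat_pos one_pos n
  unfold gaussTerm; positivity

theorem summable_gaussTerm {a b C : ℝ} (ha : 0 < a) (hb : 0 < b) (hC : a + b < C) :
    Summable (gaussTerm a b C) := by
  obtain ⟨K, hK, h⟩ := exists_Gamma_ratio_two_le ha hb one_pos (show 0 < C by linarith)
  refine Summable.of_nonneg_of_le (gaussTerm_nonneg ha hb (by linarith)) h
    ((summable_add_one_rpow (by linarith)).mul_left K)

theorem tendsto_mul_gaussTerm {a b C : ℝ} (ha : 0 < a) (hb : 0 < b) (hC : a + b < C) :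
    Tendsto (fun n : ℕ => n * gaussTerm a b C n) atTop (𝓝 0) := by
  obtain ⟨K, hK, h⟩ := exists_Gamma_ratio_two_le ha hb one_pos (show 0 < C by linarith)
  have h0 := (tendsto_add_one_rpow (show a + b - C < 0 by linarith)).const_mul K
  rw [mul_zero] at h0
  refine squeeze_zero (fun n => ?_) (fun n => ?_) h0
  · exact mul_nonneg n.cast_nonneg (gaussTerm_nonneg ha hb (by linarith) n)
  · have hpos : (0 : ℝ) < (n : ℝ) + 1 := by positivity
    calc (n : ℝ) * gaussTerm a b C n ≤ (n + 1) * (K * ((n : ℝ) + 1) ^ (a + b - 1 - C)) :=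
          mul_le_mul (by linarith) (h n) (gaussTerm_nonneg ha hb (by linarith) n) hpos.le
      _ = K * ((n : ℝ) + 1) ^ (a + b - C) := by
          rw [show a + b - C = 1 + (a + b - 1 - C) by ring, Real.rpow_add hpos, Real.rpow_one]
          ring

theorem hasSum_sub_of_tendsto {Z : ℕ → ℝ} {z : ℝ} (hZ : Tendsto Z atTop (𝓝 z))
    {f : ℕ → ℝ} (hf : Summable f) (h : ∀ n, f n = Z (n + 1) - Z n) : ∑' n, f n = z - Z 0 := by
  have h1 : Tendsto (fun n => ∑ i ∈ Finset.range n, f i) atTop (𝓝 (z - Z 0)) := by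
    simp only [h, Finset.sum_range_sub]
    exact hZ.sub_const _
  exact tendsto_nhds_unique hf.hasSum.tendsto_sum_nat h1

theorem gauss_recursion {a b C : ℝ} (ha : 0 < a) (hb : 0 < b) (hC : a + b < C) :
    (C - a) * (C - b) * ∑' n, gaussTerm a b (C + 1) n =
      (C - a - b) * ∑' n, gaussTerm a b C n := by
  have s1 := summable_gaussTerm ha hb (show a + b < C + 1 by linarith)
  have s2 := summable_gaussTerm ha hb hC
  have := hasSum_sub_of_tendsto (tendsto_mul_gaussTerm ha hb hC)
    ((s1.mul_left ((C - a) * (C - b))).sub (s2.mul_left (C - a - b))) (fun n => by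
      have hC0 : 0 < C := by linarith
      have e : C + 1 + (n : ℝ) = C + (n + 1 : ℕ) := by push_cast; ring
      simp only [gaussTerm]
      rw [e, Gamma_add_nat_succ hC0, Gamma_add_nat_succ ha, Gamma_add_nat_succ hb,
        Gamma_add_nat_succ one_pos]
      have := Gamma_add_nat_pos ha n
      have := Gamma_add_nat_pos hb n
      have := Gamma_add_nat_pos hC0 n
      have := Gamma_add_nat_pos one_pos n
      have : 0 < C + n := by positivity
      have : (0 : ℝ) < 1 + n := by positivity
      push_cast
      field_simp
      ring)
  rw [(s1.mul_left _).tsum_sub (s2.mul_left _), tsum_mul_left, tsum_mul_left] at this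
  simp at this
  linarith

theorem gauss_periodic {a b C : ℝ} (ha : 0 < a) (hb : 0 < b) (hC : a + b < C) (m : ℕ) :
    (∑' n, gaussTerm a b (C + m) n) * (Real.Gamma (C - a + m) * Real.Gamma (C - b + m) /
      Real.Gamma (C - a - b + m)) = (∑' n, gaussTerm a b C n) *
      (Real.Gamma (C - a) * Real.Gamma (C - b) / Real.Gamma (C - a - b)) := by
  induction m with
  | zero => simp
  | succ m ih =>
    have hm : (0 : ℝ) ≤ m := m.cast_nonneg
    have hr := gauss_recursion ha hb (show a + b < C + m by linarith)
    rw [← ih, Gamma_add_nat_succ (by linarith), Gamma_add_nat_succ (by linarith),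
      Gamma_add_nat_succ (by linarith), show C + (m + 1 : ℕ) = C + m + 1 by push_cast; ring]
    have := Gamma_add_nat_pos (show 0 < C - a - b by linarith) m
    have : 0 < C - a - b + m := by linarith
    field_simp
    linear_combination (Real.Gamma (C - a + m) * Real.Gamma (C - b + m)) * hr

theorem Gamma_div_Gamma_add_nat_anti {C : ℝ} (hC : 0 < C) (n m : ℕ) :
    Real.Gamma (C + m) / Real.Gamma (C + m + n) ≤ Real.Gamma C / Real.Gamma (C + n) := by
  have hC' : 0 < C + m := by positivity
  rw [Gamma_add_nat_eq_prod hC' n, Gamma_add_nat_eq_prod hC n, div_mul_cancel_left₀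
    (Real.Gamma_pos_of_pos hC').ne', div_mul_cancel_left₀ (Real.Gamma_pos_of_pos hC).ne']
  refine inv_anti₀ (Finset.prod_pos fun j _ => by positivity) (Finset.prod_le_prod
    (fun j _ => by positivity) fun j _ => ?_)
  have : (0 : ℝ) ≤ m := m.cast_nonneg
  linarith

theorem tendsto_Gamma_div_Gamma_add_nat {C : ℝ} (hC : 0 < C) {n : ℕ} (hn : n ≠ 0) :
    Tendsto (fun m : ℕ => Real.Gamma (C + m) / Real.Gamma (C + m + n)) atTop (𝓝 0) := by
  have h := (tendsto_Gamma_ratio hC (show 0 < C + n by positivity)).mul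
    (tendsto_add_one_rpow (show -(n : ℝ) < 0 by simp; omega))
  rw [mul_zero] at h
  refine h.congr fun m => ?_
  have hpos : (0 : ℝ) < (m : ℝ) + 1 := by positivity
  rw [mul_assoc, ← Real.rpow_add hpos, show C + n - C + -(n : ℝ) = 0 by ring, Real.rpow_zero,
    mul_one, add_right_comm]

theorem tendsto_tsum_gaussTerm {a b C : ℝ} (ha : 0 < a) (hb : 0 < b) (hC : a + b < C) :
    Tendsto (fun m : ℕ => (∑' n, gaussTerm a b (C + m) n) * Real.Gamma (C + m)) atTop
      (𝓝 (Real.Gamma a * Real.Gamma b)) := by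
  have hC0 : 0 < C := by linarith
  have e : Real.Gamma a * Real.Gamma b = ∑' n : ℕ, (if n = 0 then Real.Gamma a * Real.Gamma b
      else 0) := by simp
  rw [e]
  have h := tendsto_tsum_of_dominated_convergence (𝓕 := atTop)
    (f := fun (m n : ℕ) => gaussTerm a b (C + m) n * Real.Gamma (C + m))
    (g := fun n : ℕ => if n = 0 then Real.Gamma a * Real.Gamma b else 0)
    (bound := fun n => gaussTerm a b C n * Real.Gamma C)
    ((summable_gaussTerm ha hb hC).mul_right _) (fun n => ?_) (Eventually.of_forall fun m n => ?_)
  · simpa only [tsum_mul_right] using h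
  · have e2 : ∀ m : ℕ, gaussTerm a b (C + m) n * Real.Gamma (C + m) =
        Real.Gamma (a + n) * Real.Gamma (b + n) / Real.Gamma (1 + n) *
          (Real.Gamma (C + m) / Real.Gamma (C + m + n)) := fun m => by
      unfold gaussTerm; ring
    simp only [e2]
    split_ifs with hn
    · subst hn
      have : ∀ m : ℕ, Real.Gamma (C + m) ≠ 0 := fun m => (Gamma_add_nat_pos hC0 m).ne'
      simp [this]
    · simpa using (tendsto_Gamma_div_Gamma_add_nat hC0 hn).const_mul
        (Real.Gamma (a + n) * Real.Gamma (b + n) / Real.Gamma (1 + n))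
  · have hCm : 0 < C + m := by positivity
    rw [Real.norm_of_nonneg (mul_nonneg (gaussTerm_nonneg ha hb hCm n)
      (Real.Gamma_pos_of_pos hCm).le)]
    have e2 : ∀ D : ℝ, gaussTerm a b D n * Real.Gamma D =
        Real.Gamma (a + n) * Real.Gamma (b + n) / Real.Gamma (1 + n) *
          (Real.Gamma D / Real.Gamma (D + n)) := fun m => by
      unfold gaussTerm; ring
    rw [e2, e2]
    have := Gamma_add_nat_pos ha n
    have := Gamma_add_nat_pos hb n
    have := Gamma_add_nat_pos one_pos n
    exact mul_le_mul_of_nonneg_left (Gamma_div_Gamma_add_nat_anti hC0 n m) (by positivity)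

/-- Gauss's summation theorem for real parameters. -/
theorem hasSum_gaussTerm {a b C : ℝ} (ha : 0 < a) (hb : 0 < b) (hC : a + b < C) :
    HasSum (gaussTerm a b C) (Real.Gamma a * Real.Gamma b * Real.Gamma (C - a - b) /
      (Real.Gamma (C - a) * Real.Gamma (C - b))) := by
  have p1 := Real.Gamma_pos_of_pos (show 0 < C - a by linarith)
  have p2 := Real.Gamma_pos_of_pos (show 0 < C - b by linarith)
  have p3 := Real.Gamma_pos_of_pos (show 0 < C - a - b by linarith)
  have h1 := (tendsto_Gamma_ratio (show 0 < C - a by linarith) (show 0 < C by linarith)).mul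
    (tendsto_Gamma_ratio (show 0 < C - b by linarith) (show 0 < C - a - b by linarith))
  have h2 := h1.mul (tendsto_tsum_gaussTerm ha hb hC)
  rw [one_mul, one_mul] at h2
  have h3 : (∑' n, gaussTerm a b C n) *
      (Real.Gamma (C - a) * Real.Gamma (C - b) / Real.Gamma (C - a - b)) =
      Real.Gamma a * Real.Gamma b := by
    refine tendsto_nhds_unique (tendsto_const_nhds.congr fun m => ?_) h2
    rw [← gauss_periodic ha hb hC m]
    have hpos : (0 : ℝ) < (m : ℝ) + 1 := by positivity
    have hr : ((m : ℝ) + 1) ^ (C - (C - a)) * ((m : ℝ) + 1) ^ (C - a - b - (C - b)) = 1 := by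
      rw [← Real.rpow_add hpos, show C - (C - a) + (C - a - b - (C - b)) = 0 by ring,
        Real.rpow_zero]
    have := Gamma_add_nat_pos (show 0 < C by linarith) m
    have := Gamma_add_nat_pos (show 0 < C - a - b by linarith) m
    field_simp
    linear_combination (-(Real.Gamma (C - a + m) * Real.Gamma (C - b + m) *
      ∑' n, gaussTerm a b (C + m) n)) * hr
  convert (summable_gaussTerm ha hb hC).hasSum using 1
  rw [← h3]; field_simp

theorem exists_Gamma_ratio_le_const {x y : ℝ} (hx : 0 < x) (hxy : x ≤ y) :
    ∃ C : ℝ, 0 ≤ C ∧ ∀ n : ℕ, Real.Gamma (x + n) / Real.Gamma (y + n) ≤ C := by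
  obtain ⟨C, hC, h⟩ := exists_Gamma_ratio_le hx (hx.trans_le hxy)
  refine ⟨C, hC, fun n => (h n).trans (mul_le_of_le_one_right hC ?_)⟩
  exact Real.rpow_le_one_of_one_le_of_nonpos (by linarith [n.cast_nonneg (α := ℝ)]) (by linarith)

/-- The `k`-th term of the series `∑ Γ(a+k)Γ(b+k)Γ(c+k)/(k!Γ(e+k)Γ(c+w+k))`. -/
def betaTerm (a b e c w : ℝ) (k : ℕ) : ℝ :=
  gaussTerm a b e k * (Real.Gamma (c + k) / Real.Gamma (c + w + k))

theorem betaTerm_nonneg {a b e c w : ℝ} (ha : 0 < a) (hb : 0 < b) (he : 0 < e) (hc : 0 < c)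
    (hw : 0 ≤ w) (k : ℕ) : 0 ≤ betaTerm a b e c w k :=
  mul_nonneg (gaussTerm_nonneg ha hb he k)
    (div_nonneg (Gamma_add_nat_pos hc k).le (Gamma_add_nat_pos (by linarith) k).le)

theorem summable_betaTerm {a b e c w : ℝ} (ha : 0 < a) (hb : 0 < b) (he : a + b < e)
    (hc : 0 < c) (hw : 0 ≤ w) : Summable (betaTerm a b e c w) := by
  obtain ⟨C, hC, h⟩ := exists_Gamma_ratio_le_const hc (show c ≤ c + w by linarith)
  refine Summable.of_nonneg_of_le (betaTerm_nonneg ha hb (by linarith) hc hw) (fun k => ?_)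
    ((summable_gaussTerm ha hb he).mul_right C)
  exact mul_le_mul_of_nonneg_left (h k) (gaussTerm_nonneg ha hb (by linarith) k)

theorem betaTerm_step {a b e c w : ℝ} (hc : 0 < c) (hw : 0 ≤ w) (k : ℕ) :
    betaTerm a b e c w k - betaTerm a b e (c + 1) w k = w * betaTerm a b e c (w + 1) k := by
  have := Gamma_add_nat_pos hc k
  have h1 := Gamma_add_nat_pos (show 0 < c + w by linarith) k
  have h2 : 0 < c + w + k := by positivity
  simp only [betaTerm]
  rw [show c + 1 + (k : ℝ) = c + (k + 1 : ℕ) by push_cast; ring,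
    show c + 1 + w + (k : ℝ) = c + w + (k + 1 : ℕ) by push_cast; ring,
    show c + (w + 1) + (k : ℝ) = c + w + (k + 1 : ℕ) by push_cast; ring,
    Gamma_add_nat_succ hc, Gamma_add_nat_succ (by linarith)]
  field_simp
  ring

theorem tsum_betaTerm_step {a b e c w : ℝ} (ha : 0 < a) (hb : 0 < b) (he : a + b < e)
    (hc : 0 < c) (hw : 0 ≤ w) :
    ∑' k, betaTerm a b e c w k - ∑' k, betaTerm a b e (c + 1) w k =
      w * ∑' k, betaTerm a b e c (w + 1) k := by
  rw [← (summable_betaTerm ha hb he hc hw).tsum_sub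
    (summable_betaTerm ha hb he (by linarith) hw), ← tsum_mul_left]
  exact tsum_congr (betaTerm_step hc hw)

theorem tendsto_mul_betaTerm {a b e c : ℝ} (ha : 0 < a) (hb : 0 < b) (he : 0 < e)
    (hc : 0 < c) (hu : 0 < 1 + a + b - e) :
    Tendsto (fun k : ℕ => k * (k + e - 1) * betaTerm a b e c (1 + a + b - e) k) atTop (𝓝 1) := by
  have h := ((tendsto_Gamma_ratio ha he).mul (tendsto_Gamma_ratio hb one_pos)).mul
    (tendsto_Gamma_ratio hc (show 0 < c + (1 + a + b - e) by linarith))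
  have key : ∀ x : ℝ, Tendsto (fun k : ℕ => (k + x) / ((k : ℝ) + 1)) atTop (𝓝 1) := fun x => by
    have := (tendsto_const_nhds (x := (1 : ℝ))).add
      ((tendsto_const_nhds (x := x - 1)).div_atTop
        (tendsto_atTop_add_const_right atTop 1 tendsto_natCast_atTop_atTop))
    rw [add_zero] at this
    refine this.congr fun k => ?_
    have : (k : ℝ) + 1 ≠ 0 := by positivity
    field_simp; ring
  have h2 := h.mul ((key 0).mul (key (e - 1)))
  simp only [mul_one] at h2
  refine h2.congr fun k => ?_
  have hpos : (0 : ℝ) < (k : ℝ) + 1 := by positivity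
  have hr : ((k : ℝ) + 1) ^ (e - a) * ((k : ℝ) + 1) ^ (1 - b) *
      ((k : ℝ) + 1) ^ (c + (1 + a + b - e) - c) = ((k : ℝ) + 1) ^ 2 := by
    rw [← Real.rpow_add hpos, ← Real.rpow_add hpos, ← Real.rpow_natCast]
    congr 1; push_cast; ring
  have := Gamma_add_nat_pos ha k
  have := Gamma_add_nat_pos hb k
  have := Gamma_add_nat_pos hc k
  have := Gamma_add_nat_pos he k
  have := Gamma_add_nat_pos one_pos k
  have := Gamma_add_nat_pos (show 0 < c + (1 + a + b - e) by linarith) k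
  simp only [betaTerm, gaussTerm]
  field_simp
  linear_combination (k * (k + (e - 1))) * hr

theorem tsum_betaTerm_recursion {a b e c : ℝ} (ha : 0 < a) (hb : 0 < b) (he : a + b < e)
    (hc : 0 < c) (hu : 0 < 1 + a + b - e) :
    (1 + c + b - e) * (1 + c + a - e) * ∑' k, betaTerm a b e (c + 1) (1 + a + b - e) k -
      c * (c + 1 - e) * ∑' k, betaTerm a b e c (1 + a + b - e) k = 1 := by
  have he0 : 0 < e := by linarith
  have s1 := summable_betaTerm ha hb he (show 0 < c + 1 by linarith) hu.le
  have s2 := summable_betaTerm ha hb he hc hu.le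
  have := hasSum_sub_of_tendsto (tendsto_mul_betaTerm ha hb he0 hc hu)
    ((s1.mul_left ((1 + c + b - e) * (1 + c + a - e))).sub (s2.mul_left (c * (c + 1 - e))))
    (fun k => by
      have hcu : 0 < c + (1 + a + b - e) := by linarith
      simp only [betaTerm, gaussTerm]
      rw [show c + 1 + (k : ℝ) = c + (k + 1 : ℕ) by push_cast; ring,
        show c + 1 + (1 + a + b - e) + (k : ℝ) = c + (1 + a + b - e) + (k + 1 : ℕ) by
          push_cast; ring,
        Gamma_add_nat_succ ha, Gamma_add_nat_succ hb, Gamma_add_nat_succ hc,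
        Gamma_add_nat_succ he0, Gamma_add_nat_succ one_pos, Gamma_add_nat_succ hcu]
      have := Gamma_add_nat_pos he0 k
      have := Gamma_add_nat_pos one_pos k
      have := Gamma_add_nat_pos hcu k
      have : 0 < c + (1 + a + b - e) + k := by positivity
      have : 0 < e + k := by positivity
      have : (0 : ℝ) < 1 + k := by positivity
      push_cast
      field_simp
      ring)
  rw [(s1.mul_left _).tsum_sub (s2.mul_left _), tsum_mul_left, tsum_mul_left] at this
  simpa using this

theorem Gamma_ratio_add_nat_le {x u : ℝ} (hx : 0 < x) (hu : 0 ≤ u) (k : ℕ) :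
    Real.Gamma (x + k) / Real.Gamma (x + u + k) ≤ Real.Gamma x / Real.Gamma (x + u) := by
  have hxu : 0 < x + u := by linarith
  induction k with
  | zero => simp
  | succ k ih =>
    refine le_trans ?_ ih
    rw [Gamma_add_nat_succ hx, Gamma_add_nat_succ hxu, mul_div_mul_comm]
    refine mul_le_of_le_one_left (div_nonneg (Gamma_add_nat_pos hx k).le
      (Gamma_add_nat_pos hxu k).le) ((div_le_one (by positivity)).mpr (by linarith))

theorem tendsto_tsum_betaTerm {a b e c u : ℝ} (ha : 0 < a) (hb : 0 < b) (he : a + b < e)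
    (hc : 0 < c) (hu : 0 ≤ u) :
    Tendsto (fun m : ℕ => (∑' k, betaTerm a b e (c + m) u k) * ((m : ℝ) + 1) ^ u) atTop
      (𝓝 (∑' k, gaussTerm a b e k)) := by
  have hlim : Tendsto (fun m : ℕ => Real.Gamma (c + m) / Real.Gamma (c + u + m) *
      ((m : ℝ) + 1) ^ u) atTop (𝓝 1) := by
    simpa using tendsto_Gamma_ratio hc (show 0 < c + u by linarith)
  obtain ⟨C, hC⟩ := hlim.bddAbove_range
  have hC' : ∀ m : ℕ, Real.Gamma (c + m) / Real.Gamma (c + u + m) * ((m : ℝ) + 1) ^ u ≤ C :=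
    fun m => hC ⟨m, rfl⟩
  have h := tendsto_tsum_of_dominated_convergence (𝓕 := atTop)
    (f := fun (m k : ℕ) => betaTerm a b e (c + m) u k * ((m : ℝ) + 1) ^ u)
    (g := gaussTerm a b e) (bound := fun k => gaussTerm a b e k * C)
    ((summable_gaussTerm ha hb he).mul_right _) (fun k => ?_) (Eventually.of_forall fun m k => ?_)
  · simpa only [tsum_mul_right] using h
  · have h1 := tendsto_Gamma_ratio (show 0 < c + k by positivity)
      (show 0 < c + k + u by positivity)
    have h2 := h1.const_mul (gaussTerm a b e k)
    rw [mul_one] at h2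
    refine h2.congr fun m => ?_
    simp only [betaTerm]
    rw [add_sub_cancel_left, mul_assoc, show c + (k : ℝ) + u + m = c + m + u + k by ring,
      add_right_comm]
  · have hg := gaussTerm_nonneg ha hb (show 0 < e by linarith) k
    have hcm : 0 < c + m := by positivity
    have hp : 0 ≤ ((m : ℝ) + 1) ^ u := by positivity
    rw [Real.norm_of_nonneg (mul_nonneg (betaTerm_nonneg ha hb (by linarith) hcm hu k) hp),
      betaTerm, mul_assoc]
    refine mul_le_mul_of_nonneg_left (le_trans ?_ (hC' m)) hg
    rw [add_right_comm c u]
    exact mul_le_mul_of_nonneg_right (Gamma_ratio_add_nat_le hcm hu k) hp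

/-- The difference of the two Gauss sums attached to the exponents `0` and `1 - e`. -/
theorem gauss_difference {a b e : ℝ} (ha : 0 < a) (hb : 0 < b) (he1 : e < 1)
    (he : a + b < e) :
    ∑' k, gaussTerm a b e k - ∑' k, gaussTerm (1 + a - e) (1 + b - e) (2 - e) k =
      Real.Gamma a * Real.Gamma b * Real.Gamma (1 + a - e) * Real.Gamma (1 + b - e) *
        Real.sin (Real.pi * e) / (Real.pi * Real.Gamma (1 + a + b - e)) := by
  rw [(hasSum_gaussTerm ha hb he).tsum_eq, (hasSum_gaussTerm (show 0 < 1 + a - e by linarith)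
    (show 0 < 1 + b - e by linarith) (by linarith)).tsum_eq]
  rw [show 2 - e - (1 + a - e) - (1 + b - e) = e - a - b by ring,
    show 2 - e - (1 + a - e) = 1 - a by ring, show 2 - e - (1 + b - e) = 1 - b by ring]
  have r1 := Real.Gamma_mul_Gamma_one_sub a
  have r2 := Real.Gamma_mul_Gamma_one_sub b
  have r3 := Real.Gamma_mul_Gamma_one_sub (e - a)
  have r4 := Real.Gamma_mul_Gamma_one_sub (e - b)
  have r5 := Real.Gamma_mul_Gamma_one_sub (e - a - b)
  rw [show 1 - (e - a) = 1 + a - e by ring] at r3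
  rw [show 1 - (e - b) = 1 + b - e by ring] at r4
  rw [show 1 - (e - a - b) = 1 + a + b - e by ring] at r5
  have hs : ∀ x : ℝ, 0 < x → x < 1 → 0 < Real.sin (Real.pi * x) := fun x h0 h1 =>
    Real.sin_pos_of_pos_of_lt_pi (by positivity) (by nlinarith [Real.pi_pos])
  have s1 := hs a ha (by linarith)
  have s2 := hs b hb (by linarith)
  have s3 := hs (e - a) (by linarith) (by linarith)
  have s4 := hs (e - b) (by linarith) (by linarith)
  have s5 := hs (e - a - b) (by linarith) (by linarith)
  have p1 := Real.Gamma_pos_of_pos ha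
  have p2 := Real.Gamma_pos_of_pos hb
  have p3 := Real.Gamma_pos_of_pos (show 0 < e - a by linarith)
  have p4 := Real.Gamma_pos_of_pos (show 0 < e - b by linarith)
  have p5 := Real.Gamma_pos_of_pos (show 0 < e - a - b by linarith)
  have hpi := Real.pi_pos
  have q : ∀ {x y s : ℝ}, 0 < x → x * y = Real.pi / s → y = Real.pi / (s * x) :=
    fun {x y s} hx h => by
      rw [mul_comm, ← eq_div_iff hx.ne'] at h
      rw [h, div_div]
  rw [q p1 r1, q p2 r2, q p3 r3, q p4 r4, q p5 r5]
  have trig : Real.sin (Real.pi * (e - a)) * Real.sin (Real.pi * (e - b)) -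
      Real.sin (Real.pi * a) * Real.sin (Real.pi * b) =
      Real.sin (Real.pi * e) * Real.sin (Real.pi * (e - a - b)) := by
    simp only [mul_sub, Real.sin_sub, Real.cos_sub]
    have ca := Real.sin_sq_add_cos_sq (Real.pi * a)
    have cb := Real.sin_sq_add_cos_sq (Real.pi * b)
    have ce := Real.sin_sq_add_cos_sq (Real.pi * e)
    generalize Real.sin (Real.pi * a) = sa at *
    generalize Real.sin (Real.pi * b) = sb at *
    generalize Real.sin (Real.pi * e) = se at *
    generalize Real.cos (Real.pi * a) = ca' at *
    generalize Real.cos (Real.pi * b) = cb' at *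
    generalize Real.cos (Real.pi * e) = ce' at *
    linear_combination (sa * sb) * ce
  generalize Real.sin (Real.pi * a) = sa at *
  generalize Real.sin (Real.pi * b) = sb at *
  generalize Real.sin (Real.pi * e) = se at *
  generalize Real.sin (Real.pi * (e - a)) = sea at *
  generalize Real.sin (Real.pi * (e - b)) = seb at *
  generalize Real.sin (Real.pi * (e - a - b)) = seab at *
  field_simp
  linear_combination trig

/-- Difference of the two `betaTerm` series attached to the exponents `0` and `1 - e`. -/
def betaPair (a b e c w : ℝ) : ℝ :=
  ∑' k, betaTerm a b e c w k - ∑' k, betaTerm (1 + a - e) (1 + b - e) (2 - e) (1 + c - e) w k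

section betaPair
variable {a b e c : ℝ}

theorem betaPair_recursion (ha : 0 < a) (hb : 0 < b) (he1 : e < 1) (he : a + b < e)
    (hc : 0 < c) :
    (1 + c + b - e) * (1 + c + a - e) * betaPair a b e (c + 1) (1 + a + b - e) =
      c * (c + 1 - e) * betaPair a b e c (1 + a + b - e) := by
  have h1 := tsum_betaTerm_recursion ha hb he hc (by linarith)
  have h2 := tsum_betaTerm_recursion (a := 1 + a - e) (b := 1 + b - e) (e := 2 - e)
    (c := 1 + c - e) (by linarith) (by linarith) (by linarith) (by linarith) (by linarith)
  rw [show 1 + (1 + a - e) + (1 + b - e) - (2 - e) = 1 + a + b - e by ring] at h2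
  simp only [betaPair]
  rw [show 1 + (c + 1) - e = 1 + c - e + 1 by ring]
  linear_combination h1 - h2

theorem betaPair_periodic (ha : 0 < a) (hb : 0 < b) (he1 : e < 1) (he : a + b < e)
    (hc : 0 < c) (m : ℕ) :
    betaPair a b e (c + m) (1 + a + b - e) * (Real.Gamma (1 + c + a - e + m) *
      Real.Gamma (1 + c + b - e + m) / (Real.Gamma (c + m) * Real.Gamma (c + 1 - e + m))) =
    betaPair a b e c (1 + a + b - e) * (Real.Gamma (1 + c + a - e) *
      Real.Gamma (1 + c + b - e) / (Real.Gamma c * Real.Gamma (c + 1 - e))) := by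
  induction m with
  | zero => simp
  | succ m ih =>
    have hm : (0 : ℝ) ≤ m := m.cast_nonneg
    have hr := betaPair_recursion ha hb he1 he (show 0 < c + m by linarith)
    rw [← ih, Gamma_add_nat_succ (by linarith), Gamma_add_nat_succ (by linarith),
      Gamma_add_nat_succ hc, Gamma_add_nat_succ (by linarith),
      show c + (m + 1 : ℕ) = c + m + 1 by push_cast; ring]
    have := Gamma_add_nat_pos hc m
    have := Gamma_add_nat_pos (show 0 < c + 1 - e by linarith) m
    have : 0 < c + 1 - e + m := by linarith
    have : 0 < c + m := by linarith
    field_simp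
    linear_combination (Real.Gamma (1 + c + a - e + m) * Real.Gamma (1 + c + b - e + m)) * hr

/-- Nonterminating form of Saalschütz's summation theorem. -/
theorem betaPair_eq (ha : 0 < a) (hb : 0 < b) (he1 : e < 1) (he : a + b < e) (hc : 0 < c) :
    betaPair a b e c (1 + a + b - e) =
      Real.Gamma a * Real.Gamma b * Real.Gamma (1 + a - e) * Real.Gamma (1 + b - e) *
        Real.sin (Real.pi * e) / (Real.pi * Real.Gamma (1 + a + b - e)) *
      (Real.Gamma c * Real.Gamma (c + 1 - e) /
        (Real.Gamma (1 + c + a - e) * Real.Gamma (1 + c + b - e))) := by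
  have t1 := tendsto_tsum_betaTerm ha hb he hc (show 0 ≤ 1 + a + b - e by linarith)
  have t2 := tendsto_tsum_betaTerm (a := 1 + a - e) (b := 1 + b - e) (e := 2 - e)
    (c := 1 + c - e) (by linarith) (by linarith) (by linarith) (by linarith)
    (show 0 ≤ 1 + a + b - e by linarith)
  have t3 := (t1.sub t2).mul ((tendsto_Gamma_ratio (show 0 < 1 + c + a - e by linarith) hc).mul
    (tendsto_Gamma_ratio (show 0 < 1 + c + b - e by linarith)
      (show 0 < c + 1 - e by linarith)))
  rw [gauss_difference ha hb he1 he, mul_one, mul_one] at t3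
  have p1 := Real.Gamma_pos_of_pos hc
  have p2 := Real.Gamma_pos_of_pos (show 0 < 1 + c + a - e by linarith)
  have p3 := Real.Gamma_pos_of_pos (show 0 < 1 + c + b - e by linarith)
  have p4 := Real.Gamma_pos_of_pos (show 0 < c + 1 - e by linarith)
  have key : betaPair a b e c (1 + a + b - e) * (Real.Gamma (1 + c + a - e) *
      Real.Gamma (1 + c + b - e) / (Real.Gamma c * Real.Gamma (c + 1 - e))) =
      Real.Gamma a * Real.Gamma b * Real.Gamma (1 + a - e) * Real.Gamma (1 + b - e) *
        Real.sin (Real.pi * e) / (Real.pi * Real.Gamma (1 + a + b - e)) := by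
    refine tendsto_nhds_unique (tendsto_const_nhds.congr fun m => ?_) t3
    rw [← betaPair_periodic ha hb he1 he hc m, betaPair,
      show 1 + (c + m) - e = 1 + c - e + m by ring]
    have hpos : (0 : ℝ) < (m : ℝ) + 1 := by positivity
    have hr : ((m : ℝ) + 1) ^ (1 + a + b - e) * (((m : ℝ) + 1) ^ (c - (1 + c + a - e)) *
        ((m : ℝ) + 1) ^ (c + 1 - e - (1 + c + b - e))) = 1 := by
      rw [← Real.rpow_add hpos, ← Real.rpow_add hpos, show 1 + a + b - e + (c - (1 + c + a - e) +
        (c + 1 - e - (1 + c + b - e))) = 0 by ring, Real.rpow_zero]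
    linear_combination (-(∑' k, betaTerm a b e (c + m) (1 + a + b - e) k -
      ∑' k, betaTerm (1 + a - e) (1 + b - e) (2 - e) (1 + c - e + m) (1 + a + b - e) k) *
      (Real.Gamma (1 + c + a - e + m) * Real.Gamma (1 + c + b - e + m) /
        (Real.Gamma (c + m) * Real.Gamma (c + 1 - e + m)))) * hr
  rw [← key]; field_simp

theorem betaPair_step {w : ℝ} (ha : 0 < a) (hb : 0 < b) (he1 : e < 1) (he : a + b < e)
    (hc : 0 < c) (hw : 0 ≤ w) :
    betaPair a b e c w - betaPair a b e (c + 1) w = w * betaPair a b e c (w + 1) := by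
  have h1 := tsum_betaTerm_step ha hb he hc hw
  have h2 := tsum_betaTerm_step (a := 1 + a - e) (b := 1 + b - e) (e := 2 - e)
    (c := 1 + c - e) (by linarith) (by linarith) (by linarith) (by linarith) hw
  simp only [betaPair]
  rw [show 1 + (c + 1) - e = 1 + c - e + 1 by ring]
  linear_combination h1 - h2

end betaPair

/-- The Beta function as a quotient of Gamma values. -/
def betaFn (c x : ℝ) : ℝ := Real.Gamma c * Real.Gamma x / Real.Gamma (c + x)

theorem betaFn_nonneg {c x : ℝ} (hc : 0 < c) (hx : 0 < x) : 0 ≤ betaFn c x := by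
  have := Real.Gamma_pos_of_pos hc
  have := Real.Gamma_pos_of_pos hx
  have := Real.Gamma_pos_of_pos (show 0 < c + x by linarith)
  unfold betaFn; positivity

theorem betaFn_step {c x : ℝ} (hc : 0 < c) (hx : 0 < x) :
    betaFn c x - betaFn (c + 1) x = betaFn c (x + 1) := by
  have := Real.Gamma_pos_of_pos (show 0 < c + x by linarith)
  have h2 : 0 < c + x := by linarith
  unfold betaFn
  rw [show c + 1 + x = c + x + 1 by ring, show c + (x + 1) = c + x + 1 by ring,
    Real.Gamma_add_one hc.ne', Real.Gamma_add_one hx.ne', Real.Gamma_add_one h2.ne']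
  field_simp
  ring

theorem betaFn_add_nat_le {c x : ℝ} (hc : 0 < c) (hx : 0 < x) (n : ℕ) :
    betaFn c (x + n) ≤ betaFn c x := by
  induction n with
  | zero => simp
  | succ n ih =>
    have hxn : 0 < x + n := by positivity
    have h1 := betaFn_step hc hxn
    have h2 := betaFn_nonneg (show 0 < c + 1 by linarith) hxn
    rw [show x + (n + 1 : ℕ) = x + n + 1 by push_cast; ring]
    linarith

theorem summable_gaussTerm_mul_betaFn {a b u c x : ℝ} (ha : 0 < a) (hb : 0 < b) (hu : a + b < u)
    (hc : 0 < c) (hx : 0 < x) : Summable fun m : ℕ => gaussTerm a b u m * betaFn c (x + m) := by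
  refine Summable.of_nonneg_of_le (fun m => ?_) (fun m => ?_)
    ((summable_gaussTerm ha hb hu).mul_right (betaFn c x))
  · exact mul_nonneg (gaussTerm_nonneg ha hb (by linarith) m) (betaFn_nonneg hc (by positivity))
  · exact mul_le_mul_of_nonneg_left (betaFn_add_nat_le hc hx m)
      (gaussTerm_nonneg ha hb (by linarith) m)

theorem betaPair_eq_tsum {a b e c : ℝ} (ha : 0 < a) (hb : 0 < b) (he1 : e < 1) (he : a + b < e)
    (hc : 0 < c) (n : ℕ) :
    Real.Gamma (1 + a + b - e + n) * betaPair a b e c (1 + a + b - e + n) =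
      Real.Gamma (1 + a - e) * Real.Gamma (1 + b - e) * Real.sin (Real.pi * e) / Real.pi *
        ∑' m : ℕ, gaussTerm a b (1 + a + b - e) m * betaFn c (1 + a + b - e + n + m) := by
  induction n generalizing c with
  | zero =>
    have hu : 0 < 1 + a + b - e := by linarith
    have h := (hasSum_gaussTerm ha hb (show a + b < c + (1 + a + b - e) by linarith)).mul_left
      (Real.Gamma c)
    have e1 : ∀ m : ℕ, gaussTerm a b (1 + a + b - e) m *
        betaFn c (1 + a + b - e + (0 : ℕ) + m) =
        Real.Gamma c * gaussTerm a b (c + (1 + a + b - e)) m := fun m => by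
      have := Gamma_add_nat_pos hu m
      have := Gamma_add_nat_pos (show 0 < c + (1 + a + b - e) by linarith) m
      have := Gamma_add_nat_pos one_pos m
      simp only [gaussTerm, betaFn, Nat.cast_zero, add_zero]
      rw [← add_assoc c]
      field_simp
    simp only [e1]
    rw [h.tsum_eq, Nat.cast_zero, add_zero, betaPair_eq ha hb he1 he hc,
      show c + (1 + a + b - e) - a - b = c + 1 - e by ring,
      show c + (1 + a + b - e) - a = 1 + c + b - e by ring,
      show c + (1 + a + b - e) - b = 1 + c + a - e by ring]
    have := Real.Gamma_pos_of_pos hu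
    have := Real.pi_pos
    field_simp
  | succ n ih =>
    have hun : 0 < 1 + a + b - e + n := by
      have : (0 : ℝ) ≤ n := n.cast_nonneg
      linarith
    have h1 := ih hc
    have h2 := ih (show 0 < c + 1 by linarith)
    have h3 := betaPair_step ha hb he1 he hc hun.le
    have hu' : a + b < 1 + a + b - e := by linarith
    have h4 : ∑' m : ℕ, gaussTerm a b (1 + a + b - e) m *
          betaFn c (1 + a + b - e + (n + 1 : ℕ) + m) =
        ∑' m : ℕ, gaussTerm a b (1 + a + b - e) m * betaFn c (1 + a + b - e + n + m) -
        ∑' m : ℕ, gaussTerm a b (1 + a + b - e) m * betaFn (c + 1) (1 + a + b - e + n + m) := by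
      rw [← (summable_gaussTerm_mul_betaFn ha hb hu' hc hun).tsum_sub
        (summable_gaussTerm_mul_betaFn ha hb hu' (by linarith) hun)]
      refine tsum_congr fun m => ?_
      rw [← mul_sub, betaFn_step hc (by positivity)]
      congr 2; push_cast; ring
    rw [h4, Gamma_add_nat_succ (by linarith),
      show 1 + a + b - e + (n + 1 : ℕ) = 1 + a + b - e + n + 1 by push_cast; ring]
    linear_combination h1 - h2 - Real.Gamma (1 + a + b - e + n) * h3

/-- The `k`-th term of the real Saalschützian series. -/
def saalTerm (a b c d e f g : ℝ) (k : ℕ) : ℝ :=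
  gaussTerm a b e k * (Real.Gamma (c + k) * Real.Gamma (d + k) /
    (Real.Gamma (f + k) * Real.Gamma (g + k)))

theorem summable_saalTerm_of_lt {a b c d e f g : ℝ} (ha : 0 < a) (hb : 0 < b) (hc : 0 < c)
    (hd : 0 < d) (hf : 0 < f) (hg : 0 < g) (he : a + b < e) (hfg : c + d ≤ f + g) :
    Summable (saalTerm a b c d e f g) := by
  obtain ⟨C, hC, h⟩ := exists_Gamma_ratio_two_le hc hd hf hg
  refine Summable.of_nonneg_of_le (fun k => ?_) (fun k => ?_)
    ((summable_gaussTerm ha hb he).mul_right C)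
  · have := Gamma_add_nat_pos hc k
    have := Gamma_add_nat_pos hd k
    have := Gamma_add_nat_pos hf k
    have := Gamma_add_nat_pos hg k
    exact mul_nonneg (gaussTerm_nonneg ha hb (by linarith) k) (by positivity)
  · refine mul_le_mul_of_nonneg_left ((h k).trans (mul_le_of_le_one_right hC ?_))
      (gaussTerm_nonneg ha hb (by linarith) k)
    exact Real.rpow_le_one_of_one_le_of_nonpos (by linarith [k.cast_nonneg (α := ℝ)])
      (by linarith)

theorem saal_interchange {a b c d e f g u : ℝ} (ha : 0 < a) (hb : 0 < b) (hc : 0 < c)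
    (hd : 0 < d) (hf : d < f) (hg : d < g) (he : a + b < e) (hu : 0 < u)
    (hfg : f + g = c + d + u) :
    HasSum (fun n : ℕ => Real.Gamma (f - d + n) * Real.Gamma (g - d + n) / Real.Gamma (1 + n) *
      ∑' k, betaTerm a b e c (u + n) k)
      (Real.Gamma (f - d) * Real.Gamma (g - d) * ∑' k, saalTerm a b c d e f g k) := by
  have hf' : 0 < f - d := by linarith
  have hg' : 0 < g - d := by linarith
  set G : ℕ → ℕ → ℝ := fun k n => gaussTerm a b e k * (Real.Gamma (c + k) *
    gaussTerm (f - d) (g - d) (c + u + k) n) with hG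
  have hGnn : ∀ p : ℕ × ℕ, 0 ≤ G p.1 p.2 := fun p =>
    mul_nonneg (gaussTerm_nonneg ha hb (by linarith) _) (mul_nonneg (Gamma_add_nat_pos hc _).le
      (gaussTerm_nonneg hf' hg' (by positivity) _))
  have hrow : ∀ k, HasSum (G k)
      (Real.Gamma (f - d) * Real.Gamma (g - d) * saalTerm a b c d e f g k) := fun k => by
    have hk : (0 : ℝ) ≤ k := k.cast_nonneg
    have h := ((hasSum_gaussTerm hf' hg' (show f - d + (g - d) < c + u + k by linarith)).mul_left
      (Real.Gamma (c + k))).mul_left (gaussTerm a b e k)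
    rw [show c + u + k - (f - d) - (g - d) = d + k by linarith,
      show c + u + k - (f - d) = g + k by linarith,
      show c + u + k - (g - d) = f + k by linarith] at h
    have e1 : Real.Gamma (f - d) * Real.Gamma (g - d) * saalTerm a b c d e f g k =
        gaussTerm a b e k * (Real.Gamma (c + k) * (Real.Gamma (f - d) * Real.Gamma (g - d) *
          Real.Gamma (d + k) / (Real.Gamma (g + k) * Real.Gamma (f + k)))) := by
      unfold saalTerm
      ring
    rw [e1]
    exact h
  have hcol : ∀ n k, G k n = Real.Gamma (f - d + n) * Real.Gamma (g - d + n) /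
      Real.Gamma (1 + n) * betaTerm a b e c (u + n) k := fun n k => by
    simp only [hG, betaTerm]
    rw [← add_assoc c u, add_right_comm (c + u)]
    simp only [gaussTerm]
    ring
  have hsum : Summable (Function.uncurry G) := by
    refine (summable_prod_of_nonneg fun p => hGnn p).mpr ⟨fun k => (hrow k).summable, ?_⟩
    refine Summable.congr ?_ fun k => (hrow k).tsum_eq.symm
    exact (summable_saalTerm_of_lt ha hb hc hd (by linarith) (by linarith) he
      (by linarith)).mul_left _
  have h1 := hsum.prod_symm.prod.hasSum
  have h2 := hsum.tsum_comm
  rw [tsum_congr fun k => (hrow k).tsum_eq, tsum_mul_left] at h2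
  simp only [hcol, tsum_mul_left] at h2
  simp only [Function.uncurry, Prod.swap, hcol, tsum_mul_left] at h1
  rwa [h2] at h1

theorem saal_difference {a b c d e f g : ℝ} (ha : 0 < a) (hb : 0 < b) (hc : 0 < c)
    (hd : 0 < d) (hf : d < f) (hg : d < g) (he : a + b < e) (he1 : e < 1)
    (hfg : e + f + g = a + b + c + d + 1) :
    Real.Gamma (f - d) * Real.Gamma (g - d) * (∑' k, saalTerm a b c d e f g k -
      ∑' k, saalTerm (1 + a - e) (1 + b - e) (1 + c - e) (1 + d - e) (2 - e) (1 + f - e)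
        (1 + g - e) k) =
      Real.Gamma (1 + a - e) * Real.Gamma (1 + b - e) * Real.sin (Real.pi * e) / Real.pi *
        ∑' n : ℕ, ∑' m : ℕ, gaussTerm (f - d) (g - d) (1 + a + b - e) n *
          gaussTerm a b (1 + a + b - e) m * betaFn c (1 + a + b - e + n + m) := by
  have hu : 0 < 1 + a + b - e := by linarith
  have h1 := saal_interchange ha hb hc hd hf hg he hu (by linarith)
  have h2 := saal_interchange (a := 1 + a - e) (b := 1 + b - e) (e := 2 - e)
    (c := 1 + c - e) (d := 1 + d - e) (f := 1 + f - e) (g := 1 + g - e) (by linarith)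
    (by linarith) (by linarith) (by linarith) (by linarith) (by linarith) (by linarith) hu
    (by linarith)
  rw [show 1 + f - e - (1 + d - e) = f - d by ring,
    show 1 + g - e - (1 + d - e) = g - d by ring] at h2
  rw [mul_sub, ← (h1.sub h2).tsum_eq, ← tsum_mul_left]
  refine tsum_congr fun n => ?_
  have h3 := betaPair_eq_tsum ha hb he1 he hc n
  have h4 := Gamma_add_nat_pos hu n
  simp only [mul_assoc, tsum_mul_left]
  rw [← mul_sub, ← betaPair]
  have h5 : betaPair a b e c (1 + a + b - e + n) = (Real.Gamma (1 + a - e) *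
      Real.Gamma (1 + b - e) * Real.sin (Real.pi * e) / Real.pi *
        ∑' m : ℕ, gaussTerm a b (1 + a + b - e) m * betaFn c (1 + a + b - e + n + m)) /
      Real.Gamma (1 + a + b - e + n) := by
    rw [← h3]; field_simp
  rw [h5]
  simp only [gaussTerm]
  ring

/-- The two-term relation for the function `L`, for real parameters in an open region. -/
theorem saal_swap_real {a b c d e f g : ℝ} (ha : 0 < a) (hb : 0 < b) (hc : 0 < c)
    (hcd : c < d) (hf : d < f) (hg : d < g) (he : a + b < e) (he1 : e < 1)
    (hfg : e + f + g = a + b + c + d + 1) :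
    Real.Gamma (f - c) * Real.Gamma (g - c) * Real.sin (Real.pi * (1 + c - d)) *
      (Real.Gamma (f - d) * Real.Gamma (g - d) * (∑' k, saalTerm a b c d e f g k -
      ∑' k, saalTerm (1 + a - e) (1 + b - e) (1 + c - e) (1 + d - e) (2 - e) (1 + f - e)
        (1 + g - e) k)) =
    Real.Gamma (1 + a - e) * Real.Gamma (1 + b - e) * Real.sin (Real.pi * e) *
      (Real.Gamma a * Real.Gamma b *
        (∑' k, saalTerm (f - d) (g - d) c (1 + c - e) (1 + c - d) (1 + a + c - e)
          (1 + b + c - e) k -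
      ∑' k, saalTerm (f - c) (g - c) d (1 + d - e) (1 + d - c) (1 + a + d - e)
        (1 + b + d - e) k)) := by
  have hu : a + b < 1 + a + b - e := by linarith
  have h1 := saal_difference ha hb hc (hc.trans hcd) hf hg he he1 hfg
  have h2 := saal_difference (a := f - d) (b := g - d) (c := c) (d := 1 + c - e)
    (e := 1 + c - d) (f := 1 + a + c - e) (g := 1 + b + c - e) (by linarith) (by linarith) hc
    (by linarith) (by linarith) (by linarith) (by linarith) (by linarith) (by linarith)
  rw [show 1 + a + c - e - (1 + c - e) = a by ring, show 1 + b + c - e - (1 + c - e) = b by ring,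
    show 1 + (f - d) + (g - d) - (1 + c - d) = 1 + a + b - e by linarith,
    show 1 + (f - d) - (1 + c - d) = f - c by ring,
    show 1 + (g - d) - (1 + c - d) = g - c by ring,
    show 1 + c - (1 + c - d) = d by ring, show 2 - (1 + c - d) = 1 + d - c by ring,
    show 1 + (1 + c - e) - (1 + c - d) = 1 + d - e by ring,
    show 1 + (1 + a + c - e) - (1 + c - d) = 1 + a + d - e by ring,
    show 1 + (1 + b + c - e) - (1 + c - d) = 1 + b + d - e by ring] at h2
  have hsym : ∑' n : ℕ, ∑' m : ℕ, gaussTerm a b (1 + a + b - e) n *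
      gaussTerm (f - d) (g - d) (1 + a + b - e) m * betaFn c (1 + a + b - e + n + m) =
      ∑' n : ℕ, ∑' m : ℕ, gaussTerm (f - d) (g - d) (1 + a + b - e) n *
        gaussTerm a b (1 + a + b - e) m * betaFn c (1 + a + b - e + n + m) := by
    have hs : Summable (Function.uncurry fun m n : ℕ => gaussTerm a b (1 + a + b - e) n *
        gaussTerm (f - d) (g - d) (1 + a + b - e) m * betaFn c (1 + a + b - e + n + m)) := by
      have hu0 : 0 < 1 + a + b - e := by linarith
      have hf' : 0 < f - d := by linarith
      have hg' : 0 < g - d := by linarith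
      have g1 := gaussTerm_nonneg ha hb hu0
      have g2 := gaussTerm_nonneg hf' hg' hu0
      have hm := (summable_gaussTerm hf' hg' (show f - d + (g - d) < 1 + a + b - e by
        linarith)).mul_of_nonneg (summable_gaussTerm ha hb hu) g2 g1
      refine Summable.of_nonneg_of_le (fun p => ?_) (fun p => ?_)
        (hm.mul_right (betaFn c (1 + a + b - e)))
      · exact mul_nonneg (mul_nonneg (g1 _) (g2 _)) (betaFn_nonneg hc (by positivity))
      · simp only [Function.uncurry]
        rw [mul_comm (gaussTerm a b _ _)]
        refine mul_le_mul_of_nonneg_left ?_ (mul_nonneg (g2 _) (g1 _))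
        have := betaFn_add_nat_le hc hu0 (p.2 + p.1)
        rwa [Nat.cast_add, ← add_assoc] at this
    rw [hs.tsum_comm]
    refine tsum_congr fun n => tsum_congr fun m => ?_
    rw [add_right_comm _ (m : ℝ), mul_comm (gaussTerm a b _ _)]
  rw [hsym] at h2
  rw [h1, h2]
  ring

theorem hasSum_of_eq {ι : Type*} {f g : ι → ℝ} {a b : ℝ} (h : HasSum f a)
    (hf : ∀ i, g i = f i) (hb : b = a) : HasSum g b := by
  obtain rfl : g = f := funext hf
  rwa [hb]

/-- `φ` has the partial fraction expansion `φ s = ∑ aᵢ / (s - xᵢ)` off the poles. -/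
def HasPF {ι : Type*} (φ : ℝ → ℝ) (a x : ι → ℝ) : Prop :=
  ∀ s, (∀ i, s ≠ x i) → HasSum (fun i => a i / (s - x i)) (φ s)

/-- The sums `∑ |bⱼ / (x - yⱼ)|` are bounded uniformly for `x ∈ X`. -/
def CauchyBdd {κ : Type*} (b y : κ → ℝ) (X : Set ℝ) : Prop :=
  ∃ M, ∀ x ∈ X, Summable (fun j => |b j / (x - y j)|) ∧ ∑' j, |b j / (x - y j)| ≤ M

theorem CauchyBdd.union {κ : Type*} {b y : κ → ℝ} {X X' : Set ℝ} (h : CauchyBdd b y X)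
    (h' : CauchyBdd b y X') : CauchyBdd b y (X ∪ X') := by
  obtain ⟨M, hM⟩ := h
  obtain ⟨M', hM'⟩ := h'
  refine ⟨max M M', fun x hx => hx.elim (fun hx => ?_) (fun hx => ?_)⟩
  · exact ⟨(hM x hx).1, (hM x hx).2.trans (le_max_left _ _)⟩
  · exact ⟨(hM' x hx).1, (hM' x hx).2.trans (le_max_right _ _)⟩

theorem CauchyBdd.sumElim {κ κ' : Type*} {b y : κ → ℝ} {b' y' : κ' → ℝ} {X : Set ℝ}
    (h : CauchyBdd b y X) (h' : CauchyBdd b' y' X) :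
    CauchyBdd (Sum.elim b b') (Sum.elim y y') X := by
  obtain ⟨M, hM⟩ := h
  obtain ⟨M', hM'⟩ := h'
  refine ⟨M + M', fun x hx => ?_⟩
  have := HasSum.sum (f := fun j => |Sum.elim b b' j / (x - Sum.elim y y' j)|)
    (hM x hx).1.hasSum (hM' x hx).1.hasSum
  exact ⟨this.summable, this.tsum_eq.le.trans (add_le_add (hM x hx).2 (hM' x hx).2)⟩

theorem cauchyBdd_of_grid {b y : ℕ → ℝ} {C p x0 y0 : ℝ} {n : ℕ → ℤ} {X : Set ℝ} (hp : 0 < p)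
    (hC : 0 ≤ C) (hb : ∀ j : ℕ, |b j| ≤ C * ((j : ℝ) + 1) ^ (-p)) (hn : Function.Injective n)
    (hy : ∀ j, y j = y0 + n j) (hX : ∀ x ∈ X, ∃ m : ℤ, x = x0 + m) :
    CauchyBdd b y X := by
  have hq : 1 < 1 / p + 1 := by
    have : 0 < 1 / p := by positivity
    linarith
  have hpq := Real.HolderConjugate.conjExponent hq
  set q := 1 / p + 1 with hqd
  set q' := Real.conjExponent q
  have hq' : 1 < q' := hpq.symm.lt
  have hpq1 : p * q = 1 + p := by rw [hqd]; field_simp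
  have s1 : Summable fun j : ℕ => (((j : ℝ) + 1) ^ (-p)) ^ q := by
    refine (summable_add_one_rpow (show -(1 + p) < -1 by linarith)).congr fun j => ?_
    rw [← Real.rpow_mul (by positivity), ← hpq1]; ring_nf
  have s2 : Summable fun k : ℤ => 1 / |(k : ℝ) + (x0 - y0)| ^ q' :=
    (Real.summable_one_div_int_add_rpow _ _).mpr hq'
  refine ⟨C * ((∑' j : ℕ, (((j : ℝ) + 1) ^ (-p)) ^ q) / q +
    (∑' k : ℤ, 1 / |(k : ℝ) + (x0 - y0)| ^ q') / q'), fun x hx => ?_⟩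
  obtain ⟨m, rfl⟩ := hX x hx
  have hinj : Function.Injective fun j => m - n j := fun i j h => hn (by simpa using h)
  have s3 : Summable fun j => 1 / |((m - n j : ℤ) : ℝ) + (x0 - y0)| ^ q' :=
    s2.comp_injective hinj
  have hbd : ∀ j, |b j / (x0 + m - y j)| ≤ C * ((((j : ℝ) + 1) ^ (-p)) ^ q / q +
      (1 / |((m - n j : ℤ) : ℝ) + (x0 - y0)| ^ q') / q') := fun j => by
    have e1 : x0 + m - y j = ((m - n j : ℤ) : ℝ) + (x0 - y0) := by
      rw [hy]; push_cast; ring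
    rw [e1, abs_div, div_eq_mul_inv]
    have hyoung := Real.young_inequality_of_nonneg
      (show 0 ≤ ((j : ℝ) + 1) ^ (-p) by positivity)
      (show 0 ≤ |((m - n j : ℤ) : ℝ) + (x0 - y0)|⁻¹ by positivity) hpq
    rw [Real.inv_rpow (abs_nonneg _)] at hyoung
    rw [one_div]
    refine le_trans (mul_le_mul_of_nonneg_right (hb j) (by positivity)) ?_
    rw [mul_assoc]
    exact mul_le_mul_of_nonneg_left hyoung hC
  have s4 := ((s1.div_const q).add (s3.div_const q')).mul_left C
  have s5 := Summable.of_nonneg_of_le (fun j => abs_nonneg (b j / (x0 + m - y j))) hbd s4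
  refine ⟨s5, (s5.tsum_le_tsum hbd s4).trans ?_⟩
  rw [tsum_mul_left, (s1.div_const q).tsum_add (s3.div_const q'), tsum_div_const, tsum_div_const]
  have h6 := tsum_comp_le_tsum_of_inj s2 (fun k => by positivity) hinj
  have hq0 : 0 < q' := by linarith
  gcongr
  exact h6

section
variable {ι κ : Type*} {φ χ : ℝ → ℝ} {a x : ι → ℝ} {b y : κ → ℝ}

theorem CauchyBdd.summable_prod (ha : Summable fun i => |a i|)
    (hU : CauchyBdd b y (Set.range x)) :
    Summable fun p : ι × κ => a p.1 * (b p.2 / (x p.1 - y p.2)) := by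
  obtain ⟨M, hM⟩ := hU
  refine Summable.of_abs ((summable_prod_of_nonneg fun p => abs_nonneg _).mpr
    ⟨fun i => ?_, ?_⟩)
  · simp only [abs_mul (a i)]
    exact (hM (x i) ⟨i, rfl⟩).1.mul_left _
  · simp only [abs_mul (a _), tsum_mul_left]
    refine Summable.of_nonneg_of_le (fun i => mul_nonneg (abs_nonneg _)
      (tsum_nonneg fun j => abs_nonneg _)) (fun i => ?_) (ha.mul_right M)
    exact mul_le_mul_of_nonneg_left (hM (x i) ⟨i, rfl⟩).2 (abs_nonneg _)

theorem HasPF.mul (hφ : HasPF φ a x) (hχ : HasPF χ b y) (hxy : ∀ i j, x i ≠ y j)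
    (hU : CauchyBdd b y (Set.range x)) (hV : CauchyBdd a x (Set.range y)) :
    HasPF (fun s => φ s * χ s) (Sum.elim (fun i => a i * χ (x i)) fun j => b j * φ (y j))
      (Sum.elim x y) := by
  intro s hs
  have hsx : ∀ i, s ≠ x i := fun i => hs (Sum.inl i)
  have hsy : ∀ j, s ≠ y j := fun j => hs (Sum.inr j)
  have h1 := hφ s hsx
  have h2 := hχ s hsy
  have j1 := hU.summable_prod h1.summable.abs
  have j2 := (hV.summable_prod h2.summable.abs).prod_symm
  have r1 := HasSum.prod_fiberwise j1.hasSum (g := fun i => a i / (s - x i) * χ (x i))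
    fun i => (hχ (x i) (hxy i)).mul_left _
  have r2 := HasSum.prod_fiberwise (hV.summable_prod h2.summable.abs).hasSum
    (g := fun j => b j / (s - y j) * φ (y j))
    fun j => (hφ (y j) fun i => (hxy i j).symm).mul_left _
  have e2 : ∑' p : κ × ι, b p.1 / (s - y p.1) * (a p.2 / (y p.1 - x p.2)) =
      ∑' p : ι × κ, b p.2 / (s - y p.2) * (a p.1 / (y p.2 - x p.1)) :=
    ((Equiv.prodComm ι κ).tsum_eq
      (fun p : κ × ι => b p.1 / (s - y p.1) * (a p.2 / (y p.1 - x p.2)))).symm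
  have e3 : φ s * χ s = ∑' p : ι × κ, a p.1 / (s - x p.1) * (b p.2 / (x p.1 - y p.2)) +
      ∑' p : κ × ι, b p.1 / (s - y p.1) * (a p.2 / (y p.1 - x p.2)) := by
    have j3 := j1.tsum_add j2
    simp only [Prod.swap] at j3
    rw [e2, ← j3, ← h1.tsum_eq, ← h2.tsum_eq,
      tsum_mul_tsum_of_summable_norm h1.summable.norm h2.summable.norm]
    refine tsum_congr fun p => ?_
    have n1 : s - x p.1 ≠ 0 := sub_ne_zero.mpr (hsx _)
    have n2 : s - y p.2 ≠ 0 := sub_ne_zero.mpr (hsy _)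
    have n3 : x p.1 - y p.2 ≠ 0 := sub_ne_zero.mpr (hxy _ _)
    have n4 : y p.2 - x p.1 ≠ 0 := sub_ne_zero.mpr (hxy _ _).symm
    field_simp
    ring
  simp only [e3]
  refine HasSum.sum ?_ ?_
  · exact hasSum_of_eq r1 (fun i => by simp [div_mul_eq_mul_div]) rfl
  · exact hasSum_of_eq r2 (fun i => by simp [div_mul_eq_mul_div]) rfl

theorem HasPF.sum_residues (hφ : HasPF φ a x) (hχ : HasPF χ b y) (hxy : ∀ i j, x i ≠ y j)
    (hU : CauchyBdd b y (Set.range x)) (ha : Summable fun i => |a i|) :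
    ∑' i, a i * χ (x i) + ∑' j, b j * φ (y j) = 0 ∧
      Summable (fun i => a i * χ (x i)) ∧ Summable (fun j => b j * φ (y j)) := by
  have j1 := hU.summable_prod ha
  have r1 := HasSum.prod_fiberwise j1.hasSum (g := fun i => a i * χ (x i))
    fun i => (hχ (x i) (hxy i)).mul_left _
  have r2 := HasSum.prod_fiberwise j1.prod_symm.hasSum
    (g := fun j => -(b j * φ (y j))) fun j => by
      have := ((hφ (y j) fun i => (hxy i j).symm).mul_left (b j)).neg
      refine hasSum_of_eq this (fun i => ?_) rfl
      have n3 : x i - y j ≠ 0 := sub_ne_zero.mpr (hxy _ _)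
      have n4 : y j - x i ≠ 0 := sub_ne_zero.mpr (hxy _ _).symm
      simp only [Prod.swap]
      field_simp
      ring
  have e2 : ∑' p : κ × ι, a p.swap.1 * (b p.swap.2 / (x p.swap.1 - y p.swap.2)) =
      ∑' p : ι × κ, a p.1 * (b p.2 / (x p.1 - y p.2)) :=
    (Equiv.prodComm κ ι).tsum_eq (fun p : ι × κ => a p.1 * (b p.2 / (x p.1 - y p.2)))
  rw [e2] at r2
  have r3 := r2.neg
  simp only [neg_neg] at r3
  exact ⟨by rw [r1.tsum_eq, r3.tsum_eq, add_neg_cancel], r1.summable, r3.summable⟩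

end

/-- Coefficients of the partial fraction expansion of `Γ(s)/Γ(s+p)`. -/
def pfCoeff (p : ℝ) (k : ℕ) : ℝ :=
  Real.Gamma (1 - p + k) / (Real.Gamma (1 + k) * (Real.Gamma (1 - p) * Real.Gamma p))

section
variable {p : ℝ}

theorem pfCoeff_pos (hp : 0 < p) (hp1 : p < 1) (k : ℕ) : 0 < pfCoeff p k := by
  have := Gamma_add_nat_pos one_pos k
  have := Gamma_add_nat_pos (show 0 < 1 - p by linarith) k
  have := Real.Gamma_pos_of_pos hp
  have := Real.Gamma_pos_of_pos (show 0 < 1 - p by linarith)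
  unfold pfCoeff; positivity

theorem exists_pfCoeff_le (hp : 0 < p) (hp1 : p < 1) :
    ∃ C, 0 ≤ C ∧ ∀ k : ℕ, pfCoeff p k ≤ C * ((k : ℝ) + 1) ^ (-p) := by
  obtain ⟨C, hC, h⟩ := exists_Gamma_ratio_le (show 0 < 1 - p by linarith) one_pos
  have h1 := Real.Gamma_pos_of_pos hp
  have h2 := Real.Gamma_pos_of_pos (show 0 < 1 - p by linarith)
  refine ⟨C / (Real.Gamma (1 - p) * Real.Gamma p), by positivity, fun k => ?_⟩
  have := h k
  rw [show 1 - p - 1 = -p by ring] at this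
  rw [pfCoeff, ← div_div, div_mul_eq_mul_div]
  gcongr

theorem exists_pfCoeff_div_le (hp : 0 < p) (hp1 : p < 1) (s : ℝ) :
    ∃ C, ∀ k : ℕ, |pfCoeff p k / (s + k)| ≤ C * ((k : ℝ) + 1) ^ (-p - 1) := by
  obtain ⟨C, hC, h⟩ := exists_pfCoeff_le hp hp1
  have hlim : Tendsto (fun k : ℕ => |((k : ℝ) + 1) / (s + k)|) atTop (𝓝 |1|) := by
    refine Tendsto.abs ?_
    have := (tendsto_const_nhds (x := (1 : ℝ))).add
      ((tendsto_const_nhds (x := 1 - s)).div_atTop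
        (tendsto_atTop_add_const_left atTop s tendsto_natCast_atTop_atTop))
    rw [add_zero] at this
    refine this.congr' ?_
    filter_upwards [(tendsto_atTop_add_const_left atTop s
      tendsto_natCast_atTop_atTop).eventually_gt_atTop 0] with k hk
    have := hk.ne'
    field_simp; ring
  obtain ⟨M, hM⟩ := hlim.bddAbove_range
  refine ⟨C * M, fun k => ?_⟩
  have hk : (0 : ℝ) < (k : ℝ) + 1 := by positivity
  have h1 : |((k : ℝ) + 1) / (s + k)| ≤ M := hM ⟨k, rfl⟩
  have e : pfCoeff p k / (s + k) = pfCoeff p k * ((k : ℝ) + 1)⁻¹ * (((k : ℝ) + 1) / (s + k)) := by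
    field_simp
  rw [e, abs_mul, abs_of_pos (by have := pfCoeff_pos hp hp1 k; positivity),
    Real.rpow_sub hk, Real.rpow_one]
  calc _ ≤ C * ((k : ℝ) + 1) ^ (-p) * ((k : ℝ) + 1)⁻¹ * M := by
        have := pfCoeff_pos hp hp1 k
        have := h k
        gcongr
    _ = _ := by ring

theorem pfCoeff_succ (hp1 : p < 1) (k : ℕ) :
    (k + 1) * pfCoeff p (k + 1) = (1 - p + k) * pfCoeff p k := by
  have := Gamma_add_nat_pos one_pos k
  have : (0 : ℝ) < 1 + k := by positivity
  unfold pfCoeff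
  rw [Gamma_add_nat_succ (by linarith), Gamma_add_nat_succ one_pos]
  field_simp
  ring

theorem summable_pfCoeff_div (hp : 0 < p) (hp1 : p < 1) (s : ℝ) :
    Summable fun k : ℕ => pfCoeff p k / (s + k) := by
  obtain ⟨C, h⟩ := exists_pfCoeff_div_le hp hp1 s
  exact Summable.of_abs (Summable.of_nonneg_of_le (fun k => abs_nonneg _) h
    ((summable_add_one_rpow (by linarith)).mul_left C))

theorem hasSum_pfCoeff_of_pos (hp : 0 < p) (hp1 : p < 1) {s : ℝ} (hs : 0 < s) :
    HasSum (fun k : ℕ => pfCoeff p k / (s + k)) (Real.Gamma s / Real.Gamma (s + p)) := by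
  have h := (hasSum_gaussTerm (show 0 < 1 - p by linarith) hs
    (show 1 - p + s < s + 1 by linarith)).div_const (Real.Gamma (1 - p) * Real.Gamma p)
  have h1 := Real.Gamma_pos_of_pos hp
  have h2 := Real.Gamma_pos_of_pos (show 0 < 1 - p by linarith)
  have h3 := Real.Gamma_pos_of_pos (show 0 < s + p by linarith)
  rw [show s + 1 - (1 - p) - s = p by ring, show s + 1 - (1 - p) = s + p by ring,
    show s + 1 - s = 1 by ring, Real.Gamma_one] at h
  refine hasSum_of_eq h (fun k => ?_) ?_
  · have h4 := Gamma_add_nat_pos hs k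
    have h5 := Gamma_add_nat_pos one_pos k
    have : 0 < s + k := by positivity
    unfold pfCoeff gaussTerm
    rw [show s + 1 + (k : ℝ) = s + (k + 1 : ℕ) by push_cast; ring, Gamma_add_nat_succ hs]
    field_simp
  · field_simp

theorem hasSum_pfCoeff_step (hp : 0 < p) (hp1 : p < 1) {s : ℝ} (hs : ∀ k : ℕ, s + k ≠ 0)
    (h : HasSum (fun k : ℕ => pfCoeff p k / (s + 1 + k))
      (Real.Gamma (s + 1) / Real.Gamma (s + 1 + p))) :
    HasSum (fun k : ℕ => pfCoeff p k / (s + k)) (Real.Gamma s / Real.Gamma (s + p)) := by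
  obtain ⟨C, hC⟩ := exists_pfCoeff_div_le hp hp1 s
  have hZ : Tendsto (fun k : ℕ => k * (pfCoeff p k / (s + k))) atTop (𝓝 0) := by
    have h0 := (tendsto_add_one_rpow (show -p < 0 by linarith)).const_mul C
    rw [mul_zero] at h0
    refine squeeze_zero_norm (fun k => ?_) h0
    have hk : (0 : ℝ) < (k : ℝ) + 1 := by positivity
    rw [norm_mul, Real.norm_natCast, Real.norm_eq_abs]
    calc (k : ℝ) * |pfCoeff p k / (s + k)| ≤ (k + 1) * (C * ((k : ℝ) + 1) ^ (-p - 1)) :=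
          mul_le_mul (by linarith) (hC k) (abs_nonneg _) hk.le
      _ = C * ((k : ℝ) + 1) ^ (-p) := by
          rw [Real.rpow_sub hk, Real.rpow_one]; field_simp
  have sm := summable_pfCoeff_div hp hp1 s
  have hs1 : ∀ k : ℕ, s + 1 + k ≠ 0 := fun k => by
    have := hs (k + 1)
    push_cast at this
    rwa [add_assoc, add_comm 1 (k : ℝ)]
  have := hasSum_sub_of_tendsto hZ ((sm.mul_left s).sub (h.summable.mul_left (s + p)))
    (fun k => by
      have e1 := pfCoeff_succ hp1 k
      have n1 := hs k
      have n2 := hs1 k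
      have n3 : s + ((k : ℝ) + 1) ≠ 0 := by rwa [add_assoc, add_comm 1 (k : ℝ)] at n2
      push_cast
      rw [show pfCoeff p (k + 1) = (1 - p + k) * pfCoeff p k / (k + 1) by
        rw [eq_div_iff (by positivity), ← e1, mul_comm],
        show s + 1 + (k : ℝ) = s + (k + 1) by ring]
      field_simp
      ring)
  rw [(sm.mul_left _).tsum_sub (h.summable.mul_left _), tsum_mul_left, tsum_mul_left,
    h.tsum_eq] at this
  simp only [Nat.cast_zero, zero_mul, sub_zero] at this
  have s0 : s ≠ 0 := by simpa using hs 0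
  convert sm.hasSum using 1
  rw [eq_comm, ← mul_right_inj' s0, sub_eq_zero.mp this, Real.Gamma_add_one s0]
  by_cases hsp : s + p = 0
  · simp [hsp]
  · rw [show s + 1 + p = s + p + 1 by ring, Real.Gamma_add_one hsp, ← mul_div_assoc,
      mul_div_mul_left _ _ hsp, mul_div_assoc]

theorem hasSum_pfCoeff (hp : 0 < p) (hp1 : p < 1) {s : ℝ} (hs : ∀ k : ℕ, s + k ≠ 0) :
    HasSum (fun k : ℕ => pfCoeff p k / (s + k)) (Real.Gamma s / Real.Gamma (s + p)) := by
  obtain ⟨N, hN⟩ := exists_nat_gt (-s)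
  have key : ∀ m : ℕ, ∀ t : ℝ, (∀ k : ℕ, t + k ≠ 0) → 0 < t + m →
      HasSum (fun k : ℕ => pfCoeff p k / (t + k)) (Real.Gamma t / Real.Gamma (t + p)) := by
    intro m
    induction m with
    | zero => exact fun t _ h0 => hasSum_pfCoeff_of_pos hp hp1 (by simpa using h0)
    | succ m ih =>
      intro t ht h0
      refine hasSum_pfCoeff_step hp hp1 ht (ih (t + 1) (fun k => ?_) ?_)
      · have := ht (k + 1)
        push_cast at this
        rwa [add_assoc, add_comm 1 (k : ℝ)]
      · push_cast at h0; linarith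
  exact key N s hs (by linarith)

theorem hasPF_Gamma_left {a e : ℝ} (h0 : 0 < e - a) (h1 : e - a < 1) :
    HasPF (fun t => Real.Gamma (t + a) / Real.Gamma (t + e)) (pfCoeff (e - a))
      (fun k : ℕ => -a - k) := by
  intro s hs
  have := hasSum_pfCoeff h0 h1 (s := s + a) fun k h => hs k (by linarith)
  rw [show s + a + (e - a) = s + e by ring] at this
  convert this using 2 with k
  congr 1; ring

theorem hasPF_Gamma_right {x y : ℝ} (h0 : 0 < x - y) (h1 : x - y < 1) :
    HasPF (fun t => Real.Gamma (1 - x - t) / Real.Gamma (1 - y - t))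
      (fun k => -pfCoeff (x - y) k) (fun k : ℕ => 1 - x + k) := by
  intro s hs
  have := hasSum_pfCoeff h0 h1 (s := 1 - x - s) fun k h => hs k (by linarith)
  rw [show 1 - x - s + (x - y) = 1 - y - s by ring] at this
  convert this using 2 with k
  rw [neg_div, ← div_neg]
  congr 1; ring
end

theorem Real.Gamma_reflect_ratio {x y : ℝ} (hx : 0 < x) (hy : 0 < y) (k : ℕ) :
    Real.Gamma (1 - x - k) / Real.Gamma (1 - y - k) =
      Real.sin (Real.pi * y) / Real.sin (Real.pi * x) *
        (Real.Gamma (y + k) / Real.Gamma (x + k)) := by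
  have h : ∀ z : ℝ, 0 < z → Real.Gamma (1 - z - k) =
      Real.pi / ((-1) ^ k * Real.sin (Real.pi * z)) / Real.Gamma (z + k) := fun z hz => by
    rw [eq_div_iff (Gamma_add_nat_pos hz k).ne', mul_comm,
      show 1 - z - (k : ℝ) = 1 - (z + k) by ring,
      Real.Gamma_mul_Gamma_one_sub, mul_add, mul_comm Real.pi (k : ℝ), Real.sin_add_nat_mul_pi]
  rw [h x hx, h y hy]
  have := Gamma_add_nat_pos hx k
  have := Gamma_add_nat_pos hy k
  have := Real.pi_pos
  have h1 : ((-1 : ℝ) ^ k) ≠ 0 := by positivity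
  rcases eq_or_ne (Real.sin (Real.pi * x)) 0 with h2 | h2
  · simp [h2]
  rcases eq_or_ne (Real.sin (Real.pi * y)) 0 with h3 | h3
  · simp [h3]
  field_simp

theorem pfCoeff_eq_sin (p : ℝ) (k : ℕ) : pfCoeff p k =
    Real.sin (Real.pi * p) / Real.pi * (Real.Gamma (1 - p + k) / Real.Gamma (1 + k)) := by
  have : (Real.Gamma (1 - p) * Real.Gamma p)⁻¹ = Real.sin (Real.pi * p) / Real.pi := by
    rw [mul_comm, Real.Gamma_mul_Gamma_one_sub, inv_div]
  rw [pfCoeff, ← div_div, div_eq_mul_inv _ (_ * _), this]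
  ring

theorem exists_abs_le_mul_Gamma_ratio {p x y K : ℝ} (hp : 0 < p) (hp1 : p < 1) (hx : 0 < x)
    (hy : 0 < y) {u v : ℕ → ℝ} (hu : ∀ k, |u k| ≤ pfCoeff p k)
    (hv : ∀ k : ℕ, v k = K * (Real.Gamma (y + k) / Real.Gamma (x + k))) :
    ∃ C, 0 ≤ C ∧ ∀ k : ℕ, |u k * v k| ≤ C * ((k : ℝ) + 1) ^ (-(p + (x - y))) := by
  obtain ⟨C, hC, h⟩ := exists_pfCoeff_le hp hp1
  obtain ⟨C', hC', h'⟩ := exists_Gamma_ratio_le hy hx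
  refine ⟨C * |K| * C', by positivity, fun k => ?_⟩
  have hk : (0 : ℝ) < (k : ℝ) + 1 := by positivity
  have := Gamma_add_nat_pos hx k
  have := Gamma_add_nat_pos hy k
  rw [abs_mul, hv k, abs_mul, abs_of_pos (div_pos this ‹_›),
    show -(p + (x - y)) = -p + (y - x) by ring,
    Real.rpow_add hk]
  calc _ ≤ C * ((k : ℝ) + 1) ^ (-p) * (|K| * (C' * ((k : ℝ) + 1) ^ (y - x))) := by
        have h1 := (hu k).trans (h k)
        have h2 := h' k
        gcongr
    _ = _ := by ring

theorem tsum_sum_elim {u : ℕ ⊕ ℕ → ℝ} (h : Summable u) :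
    ∑' i, u i = ∑' k, u (Sum.inl k) + ∑' k, u (Sum.inr k) :=
  ((h.comp_injective Sum.inl_injective).hasSum.sum
    (h.comp_injective Sum.inr_injective).hasSum).tsum_eq

theorem summable_abs_sum_elim {u v : ℕ → ℝ} (hu : Summable fun k => |u k|)
    (hv : Summable fun k => |v k|) : Summable fun i => |Sum.elim u v i| :=
  (HasSum.sum (f := fun i => |Sum.elim u v i|) hu.hasSum hv.hasSum).summable

theorem cauchyBdd_pfCoeff {p y0 x0 : ℝ} {u y : ℕ → ℝ} {X : Set ℝ} {n : ℕ → ℤ} (hp : 0 < p)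
    (hp1 : p < 1) (hu : ∀ k, |u k| ≤ pfCoeff p k) (hn : Function.Injective n)
    (hy : ∀ j, y j = y0 + n j) (hX : ∀ x ∈ X, ∃ m : ℤ, x = x0 + m) :
    CauchyBdd u y X := by
  obtain ⟨C, hC, h⟩ := exists_pfCoeff_le hp hp1
  exact cauchyBdd_of_grid hp hC (fun j => (hu j).trans (h j)) hn hy hX

theorem injective_natCast_int : Function.Injective fun k : ℕ => (k : ℤ) := Nat.cast_injective

theorem injective_neg_natCast_int : Function.Injective fun k : ℕ => -(k : ℤ) :=
  neg_injective.comp Nat.cast_injective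

set_option maxHeartbeats 800000 in
theorem four_term_real {a b c d e f g : ℝ} (ha : 0 < a) (hae : a < e) (he : e < 1) (hb : 0 < b)
    (hc : 0 < c) (hd : 0 < d) (hdg : d < g) (hf1 : f < 1) (hbc : b + c < f) (hgf : g < f) :
    Real.sin (Real.pi * b) * (Real.sin (Real.pi * c) / Real.sin (Real.pi * f)) *
        (Real.sin (Real.pi * d) / Real.sin (Real.pi * g)) * ∑' k, saalTerm a b c d e f g k +
      Real.sin (Real.pi * (f - c)) *
        (Real.sin (Real.pi * (1 + b - f)) / Real.sin (Real.pi * (2 - f))) *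
        (Real.sin (Real.pi * (1 + d - f)) / Real.sin (Real.pi * (1 + g - f))) *
        ∑' k, saalTerm (1 + a - f) (1 + b - f) (1 + c - f) (1 + d - f) (2 - f) (1 + e - f)
          (1 + g - f) k +
      Real.sin (Real.pi * (g - d)) *
        (Real.sin (Real.pi * (1 + b - g)) / Real.sin (Real.pi * (2 - g))) *
        (Real.sin (Real.pi * (1 + c - g)) / Real.sin (Real.pi * (1 + f - g))) *
        ∑' k, saalTerm (1 + a - g) (1 + b - g) (1 + c - g) (1 + d - g) (2 - g) (1 + e - g)
          (1 + f - g) k =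
      Real.sin (Real.pi * (e - a)) *
        ∑' k, saalTerm a (1 + a - e) (1 + a - f) (1 + a - g) (1 + a - b) (1 + a - c)
          (1 + a - d) k := by
  have eq_of_int : ∀ {x y : ℝ} (i j : ℤ), x + i = y + j → |x - y| < 1 → x = y :=
      fun {x y} i j h h1 => by
    have h2 : x - y = ((j - i : ℤ) : ℝ) := by push_cast; linarith
    rw [h2, ← Int.cast_abs, ← Int.cast_one, Int.cast_lt, Int.abs_lt_one_iff] at h1
    rw [h1] at h2; simpa [sub_eq_zero] using h2
  have pos : ∀ {p : ℝ} (k : ℕ), 0 < p → p < 1 → |pfCoeff p k| ≤ pfCoeff p k :=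
    fun k h h' => (abs_of_pos (pfCoeff_pos h h' k)).le
  have neg : ∀ {p : ℝ} (k : ℕ), 0 < p → p < 1 → |-pfCoeff p k| ≤ pfCoeff p k :=
    fun k h h' => by rw [abs_neg]; exact pos k h h'
  have hR1 := hasPF_Gamma_right (x := 1) (y := b) (by linarith) (by linarith)
  have hR2 := hasPF_Gamma_right (x := f) (y := c) (by linarith) (by linarith)
  have hR3 := hasPF_Gamma_right (x := g) (y := d) (by linarith) (by linarith)
  have hA := hasPF_Gamma_left (a := a) (e := e) (by linarith) (by linarith)
  have X1 : ∀ x ∈ Set.range (fun k : ℕ => (1 : ℝ) - 1 + k), ∃ m : ℤ, x = 0 + m := by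
    rintro _ ⟨k, rfl⟩; exact ⟨k, by push_cast; ring⟩
  have X2 : ∀ {z : ℝ}, ∀ x ∈ Set.range (fun k : ℕ => 1 - z + k), ∃ m : ℤ, x = -z + m := by
    rintro z _ ⟨k, rfl⟩; exact ⟨k + 1, by push_cast; ring⟩
  have X3 : ∀ x ∈ Set.range (fun k : ℕ => -a - (k : ℝ)), ∃ m : ℤ, x = -a + m := by
    rintro _ ⟨k, rfl⟩; exact ⟨-k, by push_cast; ring⟩
  have Y2 : ∀ {z : ℝ} (k : ℕ), 1 - z + (k : ℝ) = 1 - z + ((k : ℤ) : ℝ) := fun k => by simp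
  have Y3 : ∀ k : ℕ, -a - (k : ℝ) = -a + ((-(k : ℤ) : ℤ) : ℝ) := fun k => by push_cast; ring
  have hφ := hR1.mul hR2 (fun i j h => by
      have := eq_of_int (x := 0) (y := -f) i (j + 1) (by push_cast; linarith)
        (by rw [abs_lt]; constructor <;> linarith)
      linarith)
    (cauchyBdd_pfCoeff (by linarith) (by linarith) (fun k => neg k (by linarith) (by linarith))
      injective_natCast_int Y2 X2)
    (cauchyBdd_pfCoeff (by linarith) (by linarith) (fun k => neg k (by linarith) (by linarith))
      injective_natCast_int Y2 X2)
  have hχ := hA.mul hR3 (fun i j h => by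
      have := eq_of_int (x := -a) (y := -g) (-i) (j + 1) (by push_cast; linarith)
        (by rw [abs_lt]; constructor <;> linarith)
      linarith)
    (cauchyBdd_pfCoeff (by linarith) (by linarith) (fun k => neg k (by linarith) (by linarith))
      injective_natCast_int Y2 X3)
    (cauchyBdd_pfCoeff (by linarith) (by linarith) (fun k => pos k (by linarith) (by linarith))
      injective_neg_natCast_int Y3 X2)
  have q1 : ∀ k : ℕ, Real.Gamma (1 - f - (1 - 1 + k)) / Real.Gamma (1 - c - (1 - 1 + k)) =
      Real.sin (Real.pi * c) / Real.sin (Real.pi * f) *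
        (Real.Gamma (c + k) / Real.Gamma (f + k)) := fun k => by
    rw [← Real.Gamma_reflect_ratio (by linarith) hc, sub_self, zero_add]
  have q2 : ∀ k : ℕ, Real.Gamma (1 - 1 - (1 - f + k)) / Real.Gamma (1 - b - (1 - f + k)) =
      Real.sin (Real.pi * (1 + b - f)) / Real.sin (Real.pi * (2 - f)) *
        (Real.Gamma (1 + b - f + k) / Real.Gamma (2 - f + k)) := fun k => by
    rw [← Real.Gamma_reflect_ratio (by linarith) (by linarith)]
    congr 2 <;> ring
  have q3 : ∀ k : ℕ, Real.Gamma (1 - g - (-a - k)) / Real.Gamma (1 - d - (-a - k)) =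
      1 * (Real.Gamma (1 + a - g + k) / Real.Gamma (1 + a - d + k)) := fun k => by
    rw [one_mul]; congr 2 <;> ring
  have q4 : ∀ k : ℕ, Real.Gamma (1 - g + k + a) / Real.Gamma (1 - g + k + e) =
      1 * (Real.Gamma (1 + a - g + k) / Real.Gamma (1 + e - g + k)) := fun k => by
    rw [one_mul]; congr 2 <;> ring
  have q5 : ∀ k : ℕ, Real.Gamma (1 - 1 + k + a) / Real.Gamma (1 - 1 + k + e) =
      Real.Gamma (a + k) / Real.Gamma (e + k) := fun k => by congr 2 <;> ring
  have q6 : ∀ k : ℕ, Real.Gamma (1 - g - (1 - 1 + k)) / Real.Gamma (1 - d - (1 - 1 + k)) =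
      Real.sin (Real.pi * d) / Real.sin (Real.pi * g) *
        (Real.Gamma (d + k) / Real.Gamma (g + k)) := fun k => by
    rw [← Real.Gamma_reflect_ratio (by linarith) hd, sub_self, zero_add]
  have q7 : ∀ k : ℕ, Real.Gamma (1 - f + k + a) / Real.Gamma (1 - f + k + e) =
      Real.Gamma (1 + a - f + k) / Real.Gamma (1 + e - f + k) := fun k => by congr 2 <;> ring
  have q8 : ∀ k : ℕ, Real.Gamma (1 - g - (1 - f + k)) / Real.Gamma (1 - d - (1 - f + k)) =
      Real.sin (Real.pi * (1 + d - f)) / Real.sin (Real.pi * (1 + g - f)) *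
        (Real.Gamma (1 + d - f + k) / Real.Gamma (1 + g - f + k)) := fun k => by
    rw [← Real.Gamma_reflect_ratio (by linarith) (by linarith)]
    congr 2 <;> ring
  have q9 : ∀ k : ℕ, Real.Gamma (1 - 1 - (-a - k)) / Real.Gamma (1 - b - (-a - k)) =
      Real.Gamma (a + k) / Real.Gamma (1 + a - b + k) := fun k => by congr 2 <;> ring
  have q10 : ∀ k : ℕ, Real.Gamma (1 - f - (-a - k)) / Real.Gamma (1 - c - (-a - k)) =
      Real.Gamma (1 + a - f + k) / Real.Gamma (1 + a - c + k) := fun k => by congr 2 <;> ring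
  have q11 : ∀ k : ℕ, Real.Gamma (1 - 1 - (1 - g + k)) / Real.Gamma (1 - b - (1 - g + k)) =
      Real.sin (Real.pi * (1 + b - g)) / Real.sin (Real.pi * (2 - g)) *
        (Real.Gamma (1 + b - g + k) / Real.Gamma (2 - g + k)) := fun k => by
    rw [← Real.Gamma_reflect_ratio (by linarith) (by linarith)]
    congr 2 <;> ring
  have q12 : ∀ k : ℕ, Real.Gamma (1 - f - (1 - g + k)) / Real.Gamma (1 - c - (1 - g + k)) =
      Real.sin (Real.pi * (1 + c - g)) / Real.sin (Real.pi * (1 + f - g)) *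
        (Real.Gamma (1 + c - g + k) / Real.Gamma (1 + f - g + k)) := fun k => by
    rw [← Real.Gamma_reflect_ratio (by linarith) (by linarith)]
    congr 2 <;> ring
  obtain ⟨C1, hC1, b1⟩ := exists_abs_le_mul_Gamma_ratio (p := 1 - b) (by linarith) (by linarith)
    (by linarith) hc (fun k => neg k (by linarith) (by linarith)) q1
  obtain ⟨C2, hC2, b2⟩ := exists_abs_le_mul_Gamma_ratio (p := f - c) (by linarith) (by linarith)
    (by linarith) (by linarith) (fun k => neg k (by linarith) (by linarith)) q2
  obtain ⟨C3, hC3, b3⟩ := exists_abs_le_mul_Gamma_ratio (p := e - a) (by linarith) (by linarith)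
    (by linarith) (by linarith) (fun k => pos k (by linarith) (by linarith)) q3
  obtain ⟨C4, hC4, b4⟩ := exists_abs_le_mul_Gamma_ratio (p := g - d) (by linarith) (by linarith)
    (by linarith) (by linarith) (fun k => neg k (by linarith) (by linarith)) q4
  have main := hφ.sum_residues hχ (fun i j => by
    rcases i with i | i <;> rcases j with j | j <;> intro h <;>
      simp only [Sum.elim_inl, Sum.elim_inr] at h
    · have := eq_of_int (x := 0) (y := -a) i (-j) (by push_cast; linarith)
        (by rw [abs_lt]; constructor <;> linarith)
      linarith
    · have := eq_of_int (x := 0) (y := -g) i (j + 1) (by push_cast; linarith)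
        (by rw [abs_lt]; constructor <;> linarith)
      linarith
    · have := eq_of_int (x := -f) (y := -a) (i + 1) (-j) (by push_cast; linarith)
        (by rw [abs_lt]; constructor <;> linarith)
      linarith
    · have := eq_of_int (x := -f) (y := -g) (i + 1) (j + 1) (by push_cast; linarith)
        (by rw [abs_lt]; constructor <;> linarith)
      linarith)
  obtain ⟨hres, hs1, hs2⟩ := main (by
      rw [Set.Sum.elim_range]
      exact CauchyBdd.sumElim
        ((cauchyBdd_of_grid (by linarith) hC3 b3 injective_neg_natCast_int Y3 X2).union
          (cauchyBdd_of_grid (by linarith) hC3 b3 injective_neg_natCast_int Y3 X2))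
        ((cauchyBdd_of_grid (by linarith) hC4 b4 injective_natCast_int Y2 X2).union
          (cauchyBdd_of_grid (by linarith) hC4 b4 injective_natCast_int Y2 X2))) (by
      refine summable_abs_sum_elim ?_ ?_
      · exact Summable.of_nonneg_of_le (fun k => abs_nonneg _) b1
          ((summable_add_one_rpow (by linarith)).mul_left C1)
      · exact Summable.of_nonneg_of_le (fun k => abs_nonneg _) b2
          ((summable_add_one_rpow (by linarith)).mul_left C2))
  have p1 : ∀ k, pfCoeff (1 - b) k = Real.sin (Real.pi * b) / Real.pi *
      (Real.Gamma (b + k) / Real.Gamma (1 + k)) := fun k => by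
    rw [pfCoeff_eq_sin, sub_sub_cancel, mul_sub, mul_one, Real.sin_pi_sub]
  have p2 : ∀ k, pfCoeff (f - c) k = Real.sin (Real.pi * (f - c)) / Real.pi *
      (Real.Gamma (1 + c - f + k) / Real.Gamma (1 + k)) := fun k => by
    rw [pfCoeff_eq_sin, show 1 - (f - c) = 1 + c - f by ring]
  have p3 : ∀ k, pfCoeff (e - a) k = Real.sin (Real.pi * (e - a)) / Real.pi *
      (Real.Gamma (1 + a - e + k) / Real.Gamma (1 + k)) := fun k => by
    rw [pfCoeff_eq_sin, show 1 - (e - a) = 1 + a - e by ring]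
  have p4 : ∀ k, pfCoeff (g - d) k = Real.sin (Real.pi * (g - d)) / Real.pi *
      (Real.Gamma (1 + d - g + k) / Real.Gamma (1 + k)) := fun k => by
    rw [pfCoeff_eq_sin, show 1 - (g - d) = 1 + d - g by ring]
  rw [tsum_sum_elim hs1, tsum_sum_elim hs2] at hres
  simp only [Sum.elim_inl, Sum.elim_inr, q1, q2, q3, q4, q5, q6, q7, q8, q9, q10, q11, q12,
    p1, p2, p3, p4] at hres
  have hpi := Real.pi_ne_zero
  have c1 : ∀ s u r t : ℝ, -Real.pi * (-(s / Real.pi * u) * r * t) = s * u * r * t :=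
    fun s u r t => by field_simp
  have c2 : ∀ s u r t : ℝ, -Real.pi * (s / Real.pi * u * r * t) = -(s * u * r * t) :=
    fun s u r t => by field_simp
  simp only [← tsum_mul_left]
  have key := congrArg (fun z => -Real.pi * z) hres
  simp only [mul_add, mul_zero, ← tsum_mul_left, c1, c2] at key
  have hr : ∀ x y z w : ℝ, x + y + z - w = x + y + (-w + z) := fun x y z w => by ring
  rw [← sub_eq_zero, ← key, hr, ← tsum_neg]
  simp only [saalTerm, gaussTerm]
  congr 1 <;> congr 1 <;> exact tsum_congr fun k => by ring

/-- The term of the Saalschützian series divided by `Γ(a)Γ(b)Γ(c)Γ(d)`, an entire function of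
the parameters. -/
def regTerm (a b c d e f g : ℂ) (k : ℕ) : ℂ :=
  (∏ j ∈ Finset.range k, (a + j)) * (∏ j ∈ Finset.range k, (b + j)) *
    (∏ j ∈ Finset.range k, (c + j)) * (∏ j ∈ Finset.range k, (d + j)) / k.factorial *
    ((Complex.Gamma (e + k))⁻¹ * (Complex.Gamma (f + k))⁻¹ * (Complex.Gamma (g + k))⁻¹)

/-- The series `F*(a,b,c,d;e,f,g)` divided by `Γ(a)Γ(b)Γ(c)Γ(d)`. -/
def regSum (a b c d e f g : ℂ) : ℂ := ∑' k, regTerm a b c d e f g k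

theorem regTerm_succ_mul (a b c d : ℂ) {e f g : ℂ} {k : ℕ} (he : e + k ≠ 0) (hf : f + k ≠ 0)
    (hg : g + k ≠ 0) :
    regTerm a b c d e f g (k + 1) * (((k : ℂ) + 1) * (e + k) * (f + k) * (g + k)) =
      regTerm a b c d e f g k * ((a + k) * (b + k) * (c + k) * (d + k)) := by
  have h : ∀ x : ℂ, x + k ≠ 0 → (Complex.Gamma (x + (k + 1 : ℕ)))⁻¹ * (x + k) =
      (Complex.Gamma (x + k))⁻¹ := fun x hx => by
    rw [Nat.cast_succ, ← add_assoc, Complex.Gamma_add_one _ hx, mul_inv]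
    field_simp
  have hk : (k : ℂ) + 1 ≠ 0 := Nat.cast_add_one_ne_zero k
  unfold regTerm
  rw [← h e he, ← h f hf, ← h g hg]
  simp only [Finset.prod_range_succ, Nat.factorial_succ]
  generalize (Complex.Gamma (e + (k + 1 : ℕ)))⁻¹ = E
  generalize (Complex.Gamma (f + (k + 1 : ℕ)))⁻¹ = F
  generalize (Complex.Gamma (g + (k + 1 : ℕ)))⁻¹ = G
  push_cast
  rw [div_eq_mul_inv _ (((k : ℂ) + 1) * _), mul_inv, div_eq_mul_inv]
  generalize ∏ j ∈ Finset.range k, (a + j) = A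
  generalize ∏ j ∈ Finset.range k, (b + j) = B
  generalize ∏ j ∈ Finset.range k, (c + j) = C
  generalize ∏ j ∈ Finset.range k, (d + j) = D
  have h1 := inv_mul_cancel₀ hk
  linear_combination (A * (a + k) * B * (b + k) * C * (c + k) * D * (d + k) *
    (k.factorial : ℂ)⁻¹ * E * F * G * (e + k) * (f + k) * (g + k)) * h1

theorem norm_poly_four_le {k : ℕ} (hk : 1 ≤ k) (c0 c1 c2 c3 c4 : ℂ) :
    ‖c4 * k ^ 4 + c3 * k ^ 3 + c2 * k ^ 2 + c1 * k + c0‖ ≤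
      (‖c4‖ + ‖c3‖ + ‖c2‖ + ‖c1‖ + ‖c0‖) * (k : ℝ) ^ 4 := by
  have h1 : (1 : ℝ) ≤ k := by exact_mod_cast hk
  have e : ∀ (c : ℂ) (n : ℕ), n ≤ 4 → ‖c * k ^ n‖ ≤ ‖c‖ * (k : ℝ) ^ 4 := fun c n hn => by
    rw [norm_mul, norm_pow, Complex.norm_natCast]
    gcongr
  have e1 := e c1 1 (by norm_num)
  have e0 := e c0 0 (by norm_num)
  rw [pow_one] at e1
  rw [pow_zero, mul_one] at e0
  linarith [norm_add_le (c4 * (k : ℂ) ^ 4 + c3 * k ^ 3 + c2 * k ^ 2 + c1 * k) c0,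
    norm_add_le (c4 * (k : ℂ) ^ 4 + c3 * k ^ 3 + c2 * k ^ 2) (c1 * k),
    norm_add_le (c4 * (k : ℂ) ^ 4 + c3 * k ^ 3) (c2 * k ^ 2),
    norm_add_le (c4 * (k : ℂ) ^ 4) (c3 * k ^ 3), e c4 4 le_rfl, e c3 3 (by norm_num),
    e c2 2 (by norm_num)]

/-- The sum of the norms of the coefficients of
`(k+a)(k+b)(k+c)(k+d)(k+1)² - (k+1)(k+e)(k+f)(k+g)k²`. -/
def ratioBound (a b c d e f g : ℂ) : ℝ :=
  ‖(a * b + a * c + a * d + b * c + b * d + c * d) + 2 * (a + b + c + d) + 1 -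
      (e * f + e * g + f * g) - (e + f + g)‖ +
    ‖(a * b * c + a * b * d + a * c * d + b * c * d) +
      2 * (a * b + a * c + a * d + b * c + b * d + c * d) + (a + b + c + d) - e * f * g -
      (e * f + e * g + f * g)‖ +
    ‖a * b * c * d + 2 * (a * b * c + a * b * d + a * c * d + b * c * d) +
      (a * b + a * c + a * d + b * c + b * d + c * d) - e * f * g‖ +
    ‖2 * (a * b * c * d) + (a * b * c + a * b * d + a * c * d + b * c * d)‖ + ‖a * b * c * d‖

theorem norm_regTerm_step {a b c d e f g : ℂ} (hs : e + f + g = a + b + c + d + 1) {k : ℕ}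
    (hk : 1 ≤ k) {R C : ℝ} (he : ‖e‖ ≤ R) (hf : ‖f‖ ≤ R) (hg : ‖g‖ ≤ R) (hkR : 2 * R ≤ k)
    (hC : ratioBound a b c d e f g ≤ C) :
    ‖regTerm a b c d e f g (k + 1)‖ * ((k : ℝ) + 1) ^ 2 ≤
      ‖regTerm a b c d e f g k‖ * (k : ℝ) ^ 2 * (1 + 8 * C / (k : ℝ) ^ 2) := by
  have h1 : (1 : ℝ) ≤ k := by exact_mod_cast hk
  have low : ∀ x : ℂ, ‖x‖ ≤ R → (k : ℝ) / 2 ≤ ‖x + k‖ := fun x hx => by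
    have := norm_sub_norm_le (k : ℂ) (-x)
    rw [Complex.norm_natCast, norm_neg, sub_neg_eq_add, add_comm (k : ℂ)] at this
    linarith
  have ne : ∀ x : ℂ, ‖x‖ ≤ R → x + k ≠ 0 := fun x hx h => by
    have := low x hx
    rw [h, norm_zero] at this
    linarith
  have hrec := regTerm_succ_mul a b c d (ne e he) (ne f hf) (ne g hg)
  set T := regTerm a b c d e f g k
  set T' := regTerm a b c d e f g (k + 1)
  set Q := ((k : ℂ) + 1) * (e + k) * (f + k) * (g + k) with hQ
  have hQn : (k : ℝ) ^ 4 / 8 ≤ ‖Q‖ := by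
    rw [hQ, norm_mul, norm_mul, norm_mul]
    have hk1 : (k : ℝ) ≤ ‖(k : ℂ) + 1‖ := by
      rw [show (k : ℂ) + 1 = ((k + 1 : ℕ) : ℂ) by push_cast; ring, Complex.norm_natCast]
      push_cast; linarith
    calc (k : ℝ) ^ 4 / 8 = k * (k / 2) * (k / 2) * (k / 2) := by ring
      _ ≤ _ := by
        have := low e he
        have := low f hf
        have := low g hg
        gcongr
  have hD : ‖(a + k) * (b + k) * (c + k) * (d + k) * ((k : ℂ) + 1) ^ 2 - Q * (k : ℂ) ^ 2‖ ≤
      C * (k : ℝ) ^ 4 := by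
    refine le_trans (le_of_eq ?_) ((norm_poly_four_le hk _ _ _ _ _).trans
      (mul_le_mul_of_nonneg_right hC (by positivity)))
    congr 1
    rw [hQ]
    linear_combination (-(k : ℂ) ^ 5) * hs
  have hQ0 : 0 < ‖Q‖ := lt_of_lt_of_le (by positivity) hQn
  have hk0 : (0 : ℝ) < (k : ℝ) ^ 2 := by positivity
  have hP : ‖(a + k) * (b + k) * (c + k) * (d + k)‖ * ((k : ℝ) + 1) ^ 2 ≤
      ‖Q‖ * (k : ℝ) ^ 2 * (1 + 8 * C / (k : ℝ) ^ 2) := by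
    have hC0 : 0 ≤ C := le_trans (by unfold ratioBound; positivity) hC
    have e1 : ‖(a + k) * (b + k) * (c + k) * (d + k)‖ * ((k : ℝ) + 1) ^ 2 =
        ‖(a + k) * (b + k) * (c + k) * (d + k) * ((k : ℂ) + 1) ^ 2‖ := by
      rw [norm_mul _ (_ ^ 2), norm_pow, show (k : ℂ) + 1 = ((k + 1 : ℕ) : ℂ) by push_cast; ring,
        Complex.norm_natCast]
      push_cast; ring
    have e2 : ‖Q * (k : ℂ) ^ 2‖ = ‖Q‖ * (k : ℝ) ^ 2 := by
      rw [norm_mul, norm_pow, Complex.norm_natCast]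
    have e3 := norm_sub_norm_le ((a + k) * (b + k) * (c + k) * (d + k) * ((k : ℂ) + 1) ^ 2)
      (Q * (k : ℂ) ^ 2)
    have e4 : ‖Q‖ * (k : ℝ) ^ 2 * (1 + 8 * C / (k : ℝ) ^ 2) = ‖Q‖ * (k : ℝ) ^ 2 + 8 * C * ‖Q‖ := by
      field_simp
    rw [e1, e4]
    have e5 : 8 * C * ((k : ℝ) ^ 4 / 8) ≤ 8 * C * ‖Q‖ := by gcongr
    linarith
  have hr : ‖T'‖ * ‖Q‖ = ‖T‖ * ‖(a + k) * (b + k) * (c + k) * (d + k)‖ := by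
    rw [← norm_mul, hrec, norm_mul]
  refine le_of_mul_le_mul_right ?_ hQ0
  calc ‖T'‖ * ((k : ℝ) + 1) ^ 2 * ‖Q‖ = ‖T‖ * (‖(a + k) * (b + k) * (c + k) * (d + k)‖ *
        ((k : ℝ) + 1) ^ 2) := by rw [mul_right_comm, hr, mul_assoc]
    _ ≤ ‖T‖ * (‖Q‖ * (k : ℝ) ^ 2 * (1 + 8 * C / (k : ℝ) ^ 2)) := by gcongr
    _ = _ := by ring

theorem exists_bound_of_step {C : ℝ} (hC : 0 ≤ C) (N : ℕ) :
    ∃ M, 0 ≤ M ∧ ∀ V : ℕ → ℝ, (∀ k, 0 ≤ V k) →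
      (∀ k, N ≤ k → V (k + 1) ≤ V k * (1 + C / (k : ℝ) ^ 2)) → ∀ k, N ≤ k → V k ≤ V N * M := by
  have hs : Summable fun k : ℕ => C / (k : ℝ) ^ 2 :=
    (Real.summable_one_div_nat_pow.mpr one_lt_two).mul_left C |>.congr fun k => by ring
  refine ⟨Real.exp (∑' k : ℕ, C / (k : ℝ) ^ 2), (Real.exp_pos _).le, fun V hV h k hk => ?_⟩
  have key : V k ≤ V N * Real.exp (∑ j ∈ Finset.Ico N k, C / (j : ℝ) ^ 2) := by
    induction k, hk using Nat.le_induction with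
    | base => simp
    | succ k hk ih =>
      rw [Finset.sum_Ico_succ_top hk, Real.exp_add, ← mul_assoc]
      refine (h k hk).trans (mul_le_mul ih ?_ (by positivity) ?_)
      · rw [add_comm]; exact Real.add_one_le_exp _
      · exact mul_nonneg (hV N) (Real.exp_pos _).le
  refine key.trans (mul_le_mul_of_nonneg_left (Real.exp_le_exp.mpr ?_) (hV N))
  exact hs.sum_le_tsum _ fun _ _ => by positivity

theorem differentiable_Gamma_inv {φ : ℂ → ℂ} (h : Differentiable ℂ φ) :
    Differentiable ℂ fun z => (Complex.Gamma (φ z))⁻¹ :=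
  Complex.differentiable_one_div_Gamma.comp h

theorem differentiable_Sn {φ : ℂ → ℂ} (h : Differentiable ℂ φ) :
    Differentiable ℂ fun z => Sn (φ z) :=
  Complex.differentiable_sin.comp (h.const_mul _)

section
variable {a b c d e f g : ℂ → ℂ}

theorem differentiable_regTerm (ha : Differentiable ℂ a) (hb : Differentiable ℂ b)
    (hc : Differentiable ℂ c) (hd : Differentiable ℂ d) (he : Differentiable ℂ e)
    (hf : Differentiable ℂ f) (hg : Differentiable ℂ g) (k : ℕ) :
    Differentiable ℂ fun z => regTerm (a z) (b z) (c z) (d z) (e z) (f z) (g z) k := by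
  have hp : ∀ {φ : ℂ → ℂ}, Differentiable ℂ φ →
      Differentiable ℂ fun z => ∏ j ∈ Finset.range k, (φ z + j) := fun h =>
    Differentiable.fun_finsetProd fun j _ => h.add_const _
  exact ((((hp ha).mul (hp hb)).mul (hp hc)).mul (hp hd)).div_const _ |>.mul
    (((differentiable_Gamma_inv (he.add_const _)).mul
      (differentiable_Gamma_inv (hf.add_const _))).mul (differentiable_Gamma_inv (hg.add_const _)))

theorem differentiable_regSum (ha : Differentiable ℂ a) (hb : Differentiable ℂ b)
    (hc : Differentiable ℂ c) (hd : Differentiable ℂ d) (he : Differentiable ℂ e)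
    (hf : Differentiable ℂ f) (hg : Differentiable ℂ g)
    (hs : ∀ z, e z + f z + g z = a z + b z + c z + d z + 1) :
    Differentiable ℂ fun z => regSum (a z) (b z) (c z) (d z) (e z) (f z) (g z) := by
  intro z0
  have hK := isCompact_closedBall z0 1
  have hbd : ∀ {φ : ℂ → ℂ}, Continuous φ → ∃ B, ∀ z ∈ Metric.closedBall z0 1, ‖φ z‖ ≤ B :=
    fun h => hK.exists_bound_of_continuousOn h.continuousOn
  have hcont := fun k => (differentiable_regTerm ha hb hc hd he hf hg k).continuous
  have ca := ha.continuous
  have cb := hb.continuous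
  have cc := hc.continuous
  have cd := hd.continuous
  have ce := he.continuous
  have cf := hf.continuous
  have cg := hg.continuous
  obtain ⟨Re, hRe⟩ := hbd ce
  obtain ⟨Rf, hRf⟩ := hbd cf
  obtain ⟨Rg, hRg⟩ := hbd cg
  obtain ⟨C, hC⟩ : ∃ C, ∀ z ∈ Metric.closedBall z0 1,
      ‖ratioBound (a z) (b z) (c z) (d z) (e z) (f z) (g z)‖ ≤ C := by
    refine hK.exists_bound_of_continuousOn (Continuous.continuousOn ?_)
    unfold ratioBound
    fun_prop
  choose B hB using fun k => hbd (hcont k)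
  set R := max Re (max Rf Rg)
  obtain ⟨N, hN⟩ := exists_nat_ge (max 1 (2 * R))
  have hN1 : 1 ≤ N := by exact_mod_cast (le_max_left _ _).trans hN
  have hz0 : z0 ∈ Metric.closedBall z0 1 := Metric.mem_closedBall_self zero_le_one
  have hC0 : 0 ≤ C := (norm_nonneg _).trans (hC z0 hz0)
  obtain ⟨M, hM0, hM⟩ := exists_bound_of_step (C := 8 * C) (by positivity) N
  have hterm : ∀ k, N ≤ k → ∀ z ∈ Metric.closedBall z0 1,
      ‖regTerm (a z) (b z) (c z) (d z) (e z) (f z) (g z) k‖ ≤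
        B N * (N : ℝ) ^ 2 * M * (1 / (k : ℝ) ^ 2) := fun k hk z hz => by
    have h1 := hM (fun k => ‖regTerm (a z) (b z) (c z) (d z) (e z) (f z) (g z) k‖ * (k : ℝ) ^ 2)
      (fun k => by positivity) (fun k hk => by
        have hkN : (N : ℝ) ≤ k := by exact_mod_cast hk
        have := norm_regTerm_step (hs z) (hN1.trans hk) (R := R) (C := C)
          ((hRe z hz).trans (le_max_left _ _))
          ((hRf z hz).trans ((le_max_left _ _).trans (le_max_right _ _)))
          ((hRg z hz).trans ((le_max_right _ _).trans (le_max_right _ _)))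
          ((le_max_right _ _).trans (hN.trans hkN)) ((le_abs_self _).trans (hC z hz))
        push_cast
        exact this) k hk
    have hk0 : (0 : ℝ) < (k : ℝ) ^ 2 := by
      have : (0 : ℝ) < k := by exact_mod_cast hN1.trans hk
      positivity
    rw [mul_one_div, le_div_iff₀ hk0]
    refine h1.trans ?_
    have := hB N z hz
    gcongr
  have hsum : Summable fun k => if k < N then B k else B N * (N : ℝ) ^ 2 * M * (1 / (k : ℝ) ^ 2) :=
    ((Real.summable_one_div_nat_pow.mpr one_lt_two).mul_left (B N * (N : ℝ) ^ 2 * M)).congr_atTop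
      (by
        filter_upwards [eventually_ge_atTop N] with k hk
        rw [if_neg (not_lt.mpr hk)])
  have := Complex.differentiableOn_tsum_of_summable_norm hsum
    (U := Metric.ball z0 1)
    (fun k => (differentiable_regTerm ha hb hc hd he hf hg k).differentiableOn) Metric.isOpen_ball
    (fun k z hz => by
      have hz' := Metric.ball_subset_closedBall hz
      split_ifs with h
      · exact hB k z hz'
      · exact hterm k (not_lt.mp h) z hz')
  exact (this z0 (Metric.mem_ball_self one_pos)).differentiableAt
    (Metric.ball_mem_nhds z0 one_pos)

end

theorem eq_zero_of_real_interval {h : ℂ → ℂ} (hd : Differentiable ℂ h) {l u : ℝ} (hlu : l < u)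
    (h0 : ∀ x : ℝ, l < x → x < u → h x = 0) (z : ℂ) : h z = 0 := by
  have ha : AnalyticOnNhd ℂ h Set.univ := fun z _ => hd.analyticAt z
  have hz : AnalyticOnNhd ℂ (fun _ : ℂ => (0 : ℂ)) Set.univ := fun z _ => analyticAt_const
  set m := (l + u) / 2
  have hfr : ∃ᶠ w in 𝓝[≠] (m : ℂ), h w = (fun _ : ℂ => (0 : ℂ)) w := by
    have ht : Tendsto (fun x : ℝ => (x : ℂ)) (𝓝[>] m) (𝓝[≠] (m : ℂ)) := by
      refine tendsto_nhdsWithin_iff.mpr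
        ⟨(Complex.continuous_ofReal.tendsto m).mono_left nhdsWithin_le_nhds, ?_⟩
      filter_upwards [self_mem_nhdsWithin] with x hx
      exact fun h => (Set.mem_Ioi.mp hx).ne' (Complex.ofReal_injective h)
    refine ht.frequently (Eventually.frequently ?_)
    have : Set.Ioo m u ∈ 𝓝[>] m := Ioo_mem_nhdsGT (by simp only [m]; linarith)
    filter_upwards [this] with x hx
    exact h0 x (by simp only [m, Set.mem_Ioo] at hx; linarith [hx.1]) hx.2
  exact congrFun (ha.eq_of_frequently_eq hz hfr) z

/-- A function of six complex variables that is holomorphic along holomorphic curves and vanishes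
at the real points of a box vanishes identically. -/
theorem eq_zero_of_real_box {H : ℂ → ℂ → ℂ → ℂ → ℂ → ℂ → ℂ}
    (hH : ∀ a b c d e f : ℂ → ℂ, Differentiable ℂ a → Differentiable ℂ b → Differentiable ℂ c →
      Differentiable ℂ d → Differentiable ℂ e → Differentiable ℂ f →
      Differentiable ℂ fun z => H (a z) (b z) (c z) (d z) (e z) (f z))
    (a b c d e f : ℝ) {δ : ℝ} (hδ : 0 < δ)
    (h0 : ∀ a' b' c' d' e' f' : ℝ, |a' - a| < δ → |b' - b| < δ → |c' - c| < δ → |d' - d| < δ →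
      |e' - e| < δ → |f' - f| < δ → H a' b' c' d' e' f' = 0)
    (z1 z2 z3 z4 z5 z6 : ℂ) : H z1 z2 z3 z4 z5 z6 = 0 := by
  have key : ∀ {h : ℂ → ℂ} (t : ℝ), Differentiable ℂ h →
      (∀ x : ℝ, |x - t| < δ → h x = 0) → ∀ z, h z = 0 := fun {h} t hd hx =>
    eq_zero_of_real_interval hd (l := t - δ) (u := t + δ) (by linarith) fun x h1 h2 =>
      hx x (by rw [abs_lt]; constructor <;> linarith)
  have dc : ∀ w : ℂ, Differentiable ℂ fun _ : ℂ => w := fun w => differentiable_const w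
  have di : Differentiable ℂ fun z : ℂ => z := differentiable_id
  refine key (h := fun z => H z1 z2 z3 z4 z5 z) f
    (hH _ _ _ _ _ _ (dc _) (dc _) (dc _) (dc _) (dc _) di) (fun f' hf => ?_) z6
  refine key (h := fun z => H z1 z2 z3 z4 z f') e
    (hH _ _ _ _ _ _ (dc _) (dc _) (dc _) (dc _) di (dc _)) (fun e' he => ?_) z5
  refine key (h := fun z => H z1 z2 z3 z e' f') d
    (hH _ _ _ _ _ _ (dc _) (dc _) (dc _) di (dc _) (dc _)) (fun d' hd => ?_) z4
  refine key (h := fun z => H z1 z2 z d' e' f') c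
    (hH _ _ _ _ _ _ (dc _) (dc _) di (dc _) (dc _) (dc _)) (fun c' hc => ?_) z3
  refine key (h := fun z => H z1 z c' d' e' f') b
    (hH _ _ _ _ _ _ (dc _) di (dc _) (dc _) (dc _) (dc _)) (fun b' hb => ?_) z2
  refine key (h := fun z => H z b' c' d' e' f') a
    (hH _ _ _ _ _ _ di (dc _) (dc _) (dc _) (dc _) (dc _)) (fun a' ha => ?_) z1
  exact h0 a' b' c' d' e' f' ha hb hc hd he hf

theorem Complex.Gamma_add_nat_eq_mul_prod {x : ℂ} (hx : ∀ n : ℕ, x ≠ -n) (k : ℕ) :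
    Complex.Gamma (x + k) = Complex.Gamma x * ∏ j ∈ Finset.range k, (x + j) := by
  induction k with
  | zero => simp
  | succ k ih =>
    have : x + k ≠ 0 := fun h => hx k (eq_neg_of_add_eq_zero_left h)
    rw [Nat.cast_succ, ← add_assoc, Complex.Gamma_add_one _ this, ih, Finset.prod_range_succ]
    ring

theorem Fstar_eq_regSum {a b c d : ℂ} (ha : ∀ n : ℕ, a ≠ -n) (hb : ∀ n : ℕ, b ≠ -n)
    (hc : ∀ n : ℕ, c ≠ -n) (hd : ∀ n : ℕ, d ≠ -n) (e f g : ℂ) :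
    Fstar a b c d e f g = Complex.Gamma a * Complex.Gamma b * Complex.Gamma c * Complex.Gamma d *
      regSum a b c d e f g := by
  rw [Fstar, regSum, ← tsum_mul_left]
  refine tsum_congr fun k => ?_
  rw [add_comm _ a, add_comm _ b, add_comm _ c, add_comm _ d, add_comm _ e, add_comm _ f,
    add_comm _ g, Complex.Gamma_add_nat_eq_mul_prod ha, Complex.Gamma_add_nat_eq_mul_prod hb,
    Complex.Gamma_add_nat_eq_mul_prod hc, Complex.Gamma_add_nat_eq_mul_prod hd, regTerm]
  simp only [div_eq_mul_inv, mul_inv]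
  ring

theorem ofReal_tsum_saalTerm {a b c d : ℝ} (ha : 0 < a) (hb : 0 < b) (hc : 0 < c) (hd : 0 < d)
    (e f g : ℝ) : ((∑' k, saalTerm a b c d e f g k : ℝ) : ℂ) =
      Complex.Gamma a * Complex.Gamma b * Complex.Gamma c * Complex.Gamma d *
        regSum a b c d e f g := by
  have hn : ∀ {x : ℝ}, 0 < x → ∀ n : ℕ, (x : ℂ) ≠ -n := fun {x} hx n h => by
    have h2 : x = -(n : ℝ) := by exact_mod_cast h
    have : (0 : ℝ) ≤ n := n.cast_nonneg
    linarith
  rw [← Fstar_eq_regSum (hn ha) (hn hb) (hn hc) (hn hd), Complex.ofReal_tsum, Fstar]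
  refine tsum_congr fun k => ?_
  rw [saalTerm, gaussTerm, Gamma_one_add_nat]
  push_cast [← Complex.Gamma_ofReal]
  simp only [div_eq_mul_inv, mul_inv, add_comm (k : ℂ)]
  ring

/-- The entire function `sin(πe) · L(a,b,c,d;e;f,g)`. -/
def regL (a b c d e f g : ℂ) : ℂ :=
  regSum a b c d e f g * ((Complex.Gamma (1 + a - e))⁻¹ * (Complex.Gamma (1 + b - e))⁻¹ *
      (Complex.Gamma (1 + c - e))⁻¹ * (Complex.Gamma (1 + d - e))⁻¹) -
    regSum (1 + a - e) (1 + b - e) (1 + c - e) (1 + d - e) (2 - e) (1 + f - e) (1 + g - e) *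
      ((Complex.Gamma a)⁻¹ * (Complex.Gamma b)⁻¹ * (Complex.Gamma c)⁻¹ * (Complex.Gamma d)⁻¹)

theorem differentiable_regL {a b c d e f g : ℂ → ℂ} (ha : Differentiable ℂ a)
    (hb : Differentiable ℂ b) (hc : Differentiable ℂ c) (hd : Differentiable ℂ d)
    (he : Differentiable ℂ e) (hf : Differentiable ℂ f) (hg : Differentiable ℂ g)
    (hs : ∀ z, e z + f z + g z = a z + b z + c z + d z + 1) :
    Differentiable ℂ fun z => regL (a z) (b z) (c z) (d z) (e z) (f z) (g z) := by
  have h1 : ∀ {φ : ℂ → ℂ}, Differentiable ℂ φ → Differentiable ℂ fun z => 1 + φ z - e z :=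
    fun h => (h.const_add 1).sub he
  have h2 := differentiable_regSum (h1 ha) (h1 hb) (h1 hc) (h1 hd) (he.const_sub 2) (h1 hf) (h1 hg)
    fun z => by linear_combination hs z
  have h4 : ∀ {p q r s : ℂ → ℂ}, Differentiable ℂ p → Differentiable ℂ q → Differentiable ℂ r →
      Differentiable ℂ s → Differentiable ℂ fun z => (Complex.Gamma (p z))⁻¹ *
        (Complex.Gamma (q z))⁻¹ * (Complex.Gamma (r z))⁻¹ * (Complex.Gamma (s z))⁻¹ :=
    fun hp hq hr hs => (((differentiable_Gamma_inv hp).mul (differentiable_Gamma_inv hq)).mul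
      (differentiable_Gamma_inv hr)).mul (differentiable_Gamma_inv hs)
  exact ((differentiable_regSum ha hb hc hd he hf hg hs).mul
    (h4 (h1 ha) (h1 hb) (h1 hc) (h1 hd))).sub (h2.mul (h4 ha hb hc hd))

theorem Complex.Gamma_ne_zero_of_ofReal {x : ℝ} {z : ℂ} (hx : 0 < x) (hz : z = x) :
    Complex.Gamma z ≠ 0 :=
  Complex.Gamma_ne_zero_of_re_pos (by rw [hz]; simpa using hx)

theorem regL_swap_ofReal {a b c d e f g : ℝ} (ha : 0 < a) (hb : 0 < b) (hc : 0 < c)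
    (hcd : c < d) (hf : d < f) (hg : d < g) (he : a + b < e) (he1 : e < 1)
    (hfg : e + f + g = a + b + c + d + 1) :
    Sn (1 + c - d) * regL a b c d e f g =
      Sn e * regL (f - d) (g - d) c (1 + c - e) (1 + c - d) (1 + a + c - e) (1 + b + c - e) := by
  have h := congrArg (fun x : ℝ => (x : ℂ)) (saal_swap_real ha hb hc hcd hf hg he he1 hfg)
  simp only [Complex.ofReal_mul, Complex.ofReal_sub] at h
  rw [ofReal_tsum_saalTerm (by linarith) (by linarith) (by linarith) (by linarith),
    ofReal_tsum_saalTerm (by linarith) (by linarith) (by linarith) (by linarith),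
    ofReal_tsum_saalTerm (by linarith) (by linarith) (by linarith) (by linarith),
    ofReal_tsum_saalTerm (by linarith) (by linarith) (by linarith) (by linarith)] at h
  push_cast [← Complex.Gamma_ofReal] at h
  have p : ∀ {x : ℝ} {z : ℂ}, 0 < x → z = x → Complex.Gamma z ≠ 0 :=
    Complex.Gamma_ne_zero_of_ofReal
  have n1 := p ha rfl
  have n2 := p hb rfl
  have n3 := p hc rfl
  have n4 := p (show 0 < d by linarith) rfl
  have n5 := p (z := 1 + a - e) (show 0 < 1 + a - e by linarith) (by push_cast; ring)
  have n6 := p (z := 1 + b - e) (show 0 < 1 + b - e by linarith) (by push_cast; ring)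
  have n7 := p (z := 1 + c - e) (show 0 < 1 + c - e by linarith) (by push_cast; ring)
  have n8 := p (z := 1 + d - e) (show 0 < 1 + d - e by linarith) (by push_cast; ring)
  have n9 := p (z := f - c) (show 0 < f - c by linarith) (by push_cast; ring)
  have n10 := p (z := f - d) (show 0 < f - d by linarith) (by push_cast; ring)
  have n11 := p (z := g - c) (show 0 < g - c by linarith) (by push_cast; ring)
  have n12 := p (z := g - d) (show 0 < g - d by linarith) (by push_cast; ring)
  unfold regL Sn
  rw [show (1 : ℂ) + (f - d) - (1 + c - d) = f - c by ring,
    show (1 : ℂ) + (g - d) - (1 + c - d) = g - c by ring,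
    show (1 : ℂ) + c - (1 + c - d) = d by ring,
    show (1 : ℂ) + (1 + c - e) - (1 + c - d) = 1 + d - e by ring,
    show (2 : ℂ) - (1 + c - d) = 1 + d - c by ring,
    show (1 : ℂ) + (1 + a + c - e) - (1 + c - d) = 1 + a + d - e by ring,
    show (1 : ℂ) + (1 + b + c - e) - (1 + c - d) = 1 + b + d - e by ring]
  generalize regSum a b c d e f g = r0 at h ⊢
  generalize regSum (1 + a - e) (1 + b - e) (1 + c - e) (1 + d - e) _ _ _ = r1 at h ⊢
  generalize regSum (f - d) (g - d) _ _ _ _ _ = r2 at h ⊢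
  generalize regSum (f - c) (g - c) _ _ _ _ _ = r3 at h ⊢
  generalize Complex.Gamma a = G1 at *
  generalize Complex.Gamma b = G2 at *
  generalize Complex.Gamma c = G3 at *
  generalize Complex.Gamma d = G4 at *
  generalize Complex.Gamma (1 + a - e) = G5 at *
  generalize Complex.Gamma (1 + b - e) = G6 at *
  generalize Complex.Gamma (1 + c - e) = G7 at *
  generalize Complex.Gamma (1 + d - e) = G8 at *
  generalize Complex.Gamma (f - c) = G9 at *
  generalize Complex.Gamma (f - d) = G10 at *
  generalize Complex.Gamma (g - c) = G11 at *
  generalize Complex.Gamma (g - d) = G12 at *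
  generalize Complex.sin (Real.pi * (1 + c - d)) = S1 at *
  generalize Complex.sin (Real.pi * e) = S2 at *
  have h' := congrArg (fun x => x * (G1⁻¹ * G2⁻¹ * G3⁻¹ * G4⁻¹ * G5⁻¹ * G6⁻¹ * G7⁻¹ * G8⁻¹ *
    G9⁻¹ * G10⁻¹ * G11⁻¹ * G12⁻¹)) h
  clear h
  field_simp at h' ⊢
  linear_combination h'

/-- The invariance of `L` under the basic non-permutation symmetry of its arguments. -/
theorem regL_swap {a b c d e f g : ℂ} (hs : e + f + g = a + b + c + d + 1) :
    Sn (1 + c - d) * regL a b c d e f g =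
      Sn e * regL (f - d) (g - d) c (1 + c - e) (1 + c - d) (1 + a + c - e) (1 + b + c - e) := by
  obtain rfl : g = a + b + c + d + 1 - e - f := by linear_combination hs
  rw [← sub_eq_zero]
  refine eq_zero_of_real_box
    (H := fun a b c d e f => Sn (1 + c - d) * regL a b c d e f (a + b + c + d + 1 - e - f) -
      Sn e * regL (f - d) (a + b + c + d + 1 - e - f - d) c (1 + c - e) (1 + c - d)
        (1 + a + c - e) (1 + b + c - e)) ?_ (1 / 10) (1 / 10) (3 / 10) (6 / 10) (7 / 10) (7 / 10)
    (show (0 : ℝ) < 1 / 100 by norm_num) ?_ a b c d e f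
  · intro a b c d e f ha hb hc hd he hf
    refine ((differentiable_Sn (by fun_prop)).mul (differentiable_regL ha hb hc hd he hf
      (by fun_prop) fun z => by ring)).sub
      ((differentiable_Sn he).mul (differentiable_regL (by fun_prop) (by fun_prop) hc
        (by fun_prop) (by fun_prop) (by fun_prop) (by fun_prop) fun z => by ring))
  · intro a b c d e f ha hb hc hd he hf
    rw [abs_lt] at ha hb hc hd he hf
    have := regL_swap_ofReal (a := a) (b := b) (c := c) (d := d) (e := e) (f := f)
      (g := a + b + c + d + 1 - e - f) (by linarith) (by linarith) (by linarith) (by linarith)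
      (by linarith) (by linarith) (by linarith) (by linarith) (by ring)
    push_cast at this
    exact sub_eq_zero.mpr this

theorem Sn_ne_zero {x : ℂ} (hx : ∀ n : ℤ, x ≠ n) : Sn x ≠ 0 := by
  rw [Sn, Ne, Complex.sin_eq_zero_iff]
  rintro ⟨n, hn⟩
  rw [mul_comm, mul_left_inj' (by exact_mod_cast Real.pi_ne_zero)] at hn
  exact hx n hn

theorem Sn_add_one (x : ℂ) : Sn (1 + x) = -Sn x := by
  rw [Sn, Sn, mul_add, mul_one, add_comm, Complex.sin_add_pi]

theorem Sn_one_sub (x : ℂ) : Sn (1 - x) = Sn x := by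
  rw [Sn, Sn, mul_sub, mul_one, Complex.sin_pi_sub]

theorem regL_rotate (a b c d e f g : ℂ) : regL a b c d e f g = regL c d b a e f g := by
  have h : ∀ a b c d e f g, regSum a b c d e f g = regSum c d b a e f g :=
    fun a b c d e f g => tsum_congr fun k => by unfold regTerm; ring
  rw [regL, regL, h a, h (1 + a - e)]
  ring

theorem regL_swap_pairs (a b c d e f g : ℂ) : regL a b c d e f g = regL b a d c e g f := by
  have h : ∀ a b c d e f g, regSum a b c d e f g = regSum b a d c e g f :=
    fun a b c d e f g => tsum_congr fun k => by unfold regTerm; ring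
  rw [regL, regL, h a, h (1 + a - e)]
  ring

theorem regL_reflect {a b c d e f g : ℂ} (hs : e + f + g = a + b + c + d + 1)
    (hcd : ∀ n : ℤ, c - d ≠ n) :
    Sn (1 + g - f) * regL a b c d e f g =
      Sn e * regL (g - a) (g - b) (g - c) (g - d) (1 + g - f) (1 + g - e) g := by
  have h1 := regL_swap hs
  have h2 := regL_swap (a := c) (b := 1 + c - e) (c := g - d) (d := f - d) (e := 1 + c - d)
    (f := 1 + a + c - e) (g := 1 + b + c - e) (by linear_combination -hs)
  rw [show 1 + a + c - e - (f - d) = g - b by linear_combination -hs,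
    show 1 + b + c - e - (f - d) = g - a by linear_combination -hs,
    show 1 + (g - d) - (1 + c - d) = g - c by ring,
    show 1 + (g - d) - (f - d) = 1 + g - f by ring,
    show 1 + c + (g - d) - (1 + c - d) = g by ring,
    show 1 + (1 + c - e) + (g - d) - (1 + c - d) = 1 + g - e by ring,
    ← regL_rotate, regL_swap_pairs (g - b)] at h2
  have h3 : Sn (1 + c - d) ≠ 0 := by
    rw [add_sub_assoc, Sn_add_one]
    exact neg_ne_zero.mpr (Sn_ne_zero hcd)
  refine mul_left_cancel₀ h3 ?_
  linear_combination Sn (1 + g - f) * h1 + Sn e * h2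

theorem Sn_eq_Gamma_inv {x y : ℂ} (h : y = 1 - x) :
    Sn x = Real.pi * (Complex.Gamma x)⁻¹ * (Complex.Gamma y)⁻¹ := by
  rw [h, mul_assoc, ← mul_inv, Complex.Gamma_mul_Gamma_one_sub, inv_div,
    mul_div_cancel₀ _ (by exact_mod_cast Real.pi_ne_zero), Sn]

theorem Sn_ofReal_ne_zero {x : ℝ} {z : ℂ} (h0 : 0 < x) (h1 : x < 1) (hz : z = x) : Sn z ≠ 0 := by
  refine Sn_ne_zero fun n hn => ?_
  have hx : x = n := by rw [hz] at hn; exact_mod_cast hn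
  rw [hx] at h0 h1
  have := Int.cast_pos.mp h0
  have : n < 1 := by exact_mod_cast h1
  omega

theorem four_term_ofReal {a b c d e f g : ℝ} (ha : 0 < a) (hae : a < e) (he : e < 1) (hb : 0 < b)
    (hc : 0 < c) (hd : 0 < d) (hdg : d < g) (hf1 : f < 1) (hbc : b + c < f) (hgf : g < f) :
    (Real.pi : ℂ) ^ 2 * (Sn (f - g) * ((Complex.Gamma (1 - b))⁻¹ * (Complex.Gamma (1 - c))⁻¹ *
        (Complex.Gamma (1 - d))⁻¹ * (Complex.Gamma (1 + a - f))⁻¹ *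
        (Complex.Gamma (1 + a - g))⁻¹) * regSum a b c d e f g -
      Sn g * ((Complex.Gamma (f - b))⁻¹ * (Complex.Gamma (f - c))⁻¹ * (Complex.Gamma (f - d))⁻¹ *
        (Complex.Gamma a)⁻¹ * (Complex.Gamma (1 + a - g))⁻¹) *
        regSum (1 + a - f) (1 + b - f) (1 + c - f) (1 + d - f) (2 - f) (1 + e - f) (1 + g - f) +
      Sn f * ((Complex.Gamma (g - b))⁻¹ * (Complex.Gamma (g - c))⁻¹ * (Complex.Gamma (g - d))⁻¹ *
        (Complex.Gamma a)⁻¹ * (Complex.Gamma (1 + a - f))⁻¹) *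
        regSum (1 + a - g) (1 + b - g) (1 + c - g) (1 + d - g) (2 - g) (1 + e - g) (1 + f - g)) =
      Sn f * Sn g * Sn (f - g) * (Complex.Gamma (e - a))⁻¹ *
        regSum a (1 + a - e) (1 + a - f) (1 + a - g) (1 + a - b) (1 + a - c) (1 + a - d) := by
  have h := congrArg (fun x : ℝ => (x : ℂ))
    (four_term_real ha hae he hb hc hd hdg hf1 hbc hgf)
  simp only [Complex.ofReal_mul, Complex.ofReal_add, Complex.ofReal_div] at h
  rw [ofReal_tsum_saalTerm (by linarith) (by linarith) (by linarith) (by linarith),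
    ofReal_tsum_saalTerm (by linarith) (by linarith) (by linarith) (by linarith),
    ofReal_tsum_saalTerm (by linarith) (by linarith) (by linarith) (by linarith),
    ofReal_tsum_saalTerm (by linarith) (by linarith) (by linarith) (by linarith)] at h
  push_cast [← Complex.Gamma_ofReal] at h
  simp only [← Sn.eq_1] at h
  have p : ∀ {x : ℝ} {z : ℂ}, 0 < x → z = x → Complex.Gamma z ≠ 0 :=
    Complex.Gamma_ne_zero_of_ofReal
  have n1 := p ha rfl
  have n2 := p hb rfl
  have n3 := p hc rfl
  have n4 := p hd rfl
  have n5 := p (z := 1 + a - e) (show 0 < 1 + a - e by linarith) (by push_cast; ring)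
  have n6 := p (z := 1 + a - f) (show 0 < 1 + a - f by linarith) (by push_cast; ring)
  have n7 := p (z := 1 + b - f) (show 0 < 1 + b - f by linarith) (by push_cast; ring)
  have n8 := p (z := 1 + c - f) (show 0 < 1 + c - f by linarith) (by push_cast; ring)
  have n9 := p (z := 1 + d - f) (show 0 < 1 + d - f by linarith) (by push_cast; ring)
  have n10 := p (z := 1 + a - g) (show 0 < 1 + a - g by linarith) (by push_cast; ring)
  have n11 := p (z := 1 + b - g) (show 0 < 1 + b - g by linarith) (by push_cast; ring)
  have n12 := p (z := 1 + c - g) (show 0 < 1 + c - g by linarith) (by push_cast; ring)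
  have n13 := p (z := 1 + d - g) (show 0 < 1 + d - g by linarith) (by push_cast; ring)
  have m1 : Sn f ≠ 0 := Sn_ofReal_ne_zero (by linarith) hf1 rfl
  have m2 : Sn g ≠ 0 := Sn_ofReal_ne_zero (by linarith) (by linarith) rfl
  have m3 : Sn ((f : ℂ) - g) ≠ 0 :=
    Sn_ofReal_ne_zero (x := f - g) (by linarith) (by linarith) (by push_cast; ring)
  have s1 : ∀ z : ℂ, Sn (2 - z) = -Sn z := fun z => by
    rw [show (2 : ℂ) - z = 1 + (1 - z) by ring, Sn_add_one, Sn_one_sub]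
  have hpi : (Real.pi : ℂ) ≠ 0 := by exact_mod_cast Real.pi_ne_zero
  rw [s1, s1, show (1 : ℂ) + g - f = 1 - (f - g) by ring, Sn_one_sub,
    show (1 : ℂ) + f - g = 1 + (f - g) by ring, Sn_add_one,
    Sn_eq_Gamma_inv (x := b) rfl, Sn_eq_Gamma_inv (x := c) rfl, Sn_eq_Gamma_inv (x := d) rfl,
    Sn_eq_Gamma_inv (x := f - c) (y := 1 + c - f) (by ring),
    Sn_eq_Gamma_inv (x := 1 + b - f) (y := f - b) (by ring),
    Sn_eq_Gamma_inv (x := 1 + d - f) (y := f - d) (by ring),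
    Sn_eq_Gamma_inv (x := g - d) (y := 1 + d - g) (by ring),
    Sn_eq_Gamma_inv (x := 1 + b - g) (y := g - b) (by ring),
    Sn_eq_Gamma_inv (x := 1 + c - g) (y := g - c) (by ring),
    Sn_eq_Gamma_inv (x := e - a) (y := 1 + a - e) (by ring)] at h
  rw [show (1 : ℂ) + g - f = 1 - (f - g) by ring, show (1 : ℂ) + f - g = 1 + (f - g) by ring]
  generalize regSum a b c d e f g = r0 at h ⊢
  generalize regSum (1 + a - f) (1 + b - f) _ _ _ _ _ = r1 at h ⊢
  generalize regSum (1 + a - g) (1 + b - g) _ _ _ _ _ = r2 at h ⊢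
  generalize regSum a (1 + a - e) _ _ _ _ _ = r3 at h ⊢
  generalize Sn f = S1 at *
  generalize Sn g = S2 at *
  generalize Sn (f - g) = S3 at *
  generalize Complex.Gamma a = G1 at *
  generalize Complex.Gamma b = G2 at *
  generalize Complex.Gamma c = G3 at *
  generalize Complex.Gamma d = G4 at *
  generalize Complex.Gamma (1 + a - e) = G5 at *
  generalize Complex.Gamma (1 + a - f) = G6 at *
  generalize Complex.Gamma (1 + b - f) = G7 at *
  generalize Complex.Gamma (1 + c - f) = G8 at *
  generalize Complex.Gamma (1 + d - f) = G9 at *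
  generalize Complex.Gamma (1 + a - g) = G10 at *
  generalize Complex.Gamma (1 + b - g) = G11 at *
  generalize Complex.Gamma (1 + c - g) = G12 at *
  generalize Complex.Gamma (1 + d - g) = G13 at *
  generalize (Complex.Gamma (1 - b))⁻¹ = R1 at *
  generalize (Complex.Gamma (1 - c))⁻¹ = R2 at *
  generalize (Complex.Gamma (1 - d))⁻¹ = R3 at *
  generalize (Complex.Gamma (f - b))⁻¹ = R4 at *
  generalize (Complex.Gamma (f - c))⁻¹ = R5 at *
  generalize (Complex.Gamma (f - d))⁻¹ = R6 at *
  generalize (Complex.Gamma (g - b))⁻¹ = R7 at *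
  generalize (Complex.Gamma (g - c))⁻¹ = R8 at *
  generalize (Complex.Gamma (g - d))⁻¹ = R9 at *
  generalize (Complex.Gamma (e - a))⁻¹ = R10 at *
  field_simp at h ⊢
  linear_combination h

/-- The three-term relation with sources `F*(a,b,c,d;e,f,g)` and its companions based at `f`, `g`
and at `a`. -/
theorem regSum_four_term {a b c d e f g : ℂ} (hs : e + f + g = a + b + c + d + 1) :
    (Real.pi : ℂ) ^ 2 * (Sn (f - g) * ((Complex.Gamma (1 - b))⁻¹ * (Complex.Gamma (1 - c))⁻¹ *
        (Complex.Gamma (1 - d))⁻¹ * (Complex.Gamma (1 + a - f))⁻¹ *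
        (Complex.Gamma (1 + a - g))⁻¹) * regSum a b c d e f g -
      Sn g * ((Complex.Gamma (f - b))⁻¹ * (Complex.Gamma (f - c))⁻¹ * (Complex.Gamma (f - d))⁻¹ *
        (Complex.Gamma a)⁻¹ * (Complex.Gamma (1 + a - g))⁻¹) *
        regSum (1 + a - f) (1 + b - f) (1 + c - f) (1 + d - f) (2 - f) (1 + e - f) (1 + g - f) +
      Sn f * ((Complex.Gamma (g - b))⁻¹ * (Complex.Gamma (g - c))⁻¹ * (Complex.Gamma (g - d))⁻¹ *
        (Complex.Gamma a)⁻¹ * (Complex.Gamma (1 + a - f))⁻¹) *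
        regSum (1 + a - g) (1 + b - g) (1 + c - g) (1 + d - g) (2 - g) (1 + e - g) (1 + f - g)) =
      Sn f * Sn g * Sn (f - g) * (Complex.Gamma (e - a))⁻¹ *
        regSum a (1 + a - e) (1 + a - f) (1 + a - g) (1 + a - b) (1 + a - c) (1 + a - d) := by
  obtain ⟨G, hG⟩ : ∃ G : ℂ → ℂ → ℂ → ℂ → ℂ → ℂ → ℂ,
      G = fun a b c d e f => a + b + c + d + 1 - e - f := ⟨_, rfl⟩
  obtain rfl : g = G a b c d e f := by rw [hG]; linear_combination hs
  rw [← sub_eq_zero]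
  refine eq_zero_of_real_box
    (H := fun a b c d e f => (Real.pi : ℂ) ^ 2 * (Sn (f - G a b c d e f) *
      ((Complex.Gamma (1 - b))⁻¹ * (Complex.Gamma (1 - c))⁻¹ * (Complex.Gamma (1 - d))⁻¹ *
        (Complex.Gamma (1 + a - f))⁻¹ * (Complex.Gamma (1 + a - G a b c d e f))⁻¹) *
        regSum a b c d e f (G a b c d e f) -
      Sn (G a b c d e f) * ((Complex.Gamma (f - b))⁻¹ * (Complex.Gamma (f - c))⁻¹ *
        (Complex.Gamma (f - d))⁻¹ * (Complex.Gamma a)⁻¹ *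
        (Complex.Gamma (1 + a - G a b c d e f))⁻¹) *
        regSum (1 + a - f) (1 + b - f) (1 + c - f) (1 + d - f) (2 - f) (1 + e - f)
          (1 + G a b c d e f - f) +
      Sn f * ((Complex.Gamma (G a b c d e f - b))⁻¹ * (Complex.Gamma (G a b c d e f - c))⁻¹ *
        (Complex.Gamma (G a b c d e f - d))⁻¹ * (Complex.Gamma a)⁻¹ *
        (Complex.Gamma (1 + a - f))⁻¹) *
        regSum (1 + a - G a b c d e f) (1 + b - G a b c d e f) (1 + c - G a b c d e f)
          (1 + d - G a b c d e f) (2 - G a b c d e f) (1 + e - G a b c d e f)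
          (1 + f - G a b c d e f)) -
      Sn f * Sn (G a b c d e f) * Sn (f - G a b c d e f) * (Complex.Gamma (e - a))⁻¹ *
        regSum a (1 + a - e) (1 + a - f) (1 + a - G a b c d e f) (1 + a - b) (1 + a - c)
          (1 + a - d)) ?_ (1 / 10) (4 / 10) (3 / 10) (1 / 10) (3 / 10) (9 / 10)
    (show (0 : ℝ) < 1 / 100 by norm_num) ?_ a b c d e f
  · intro a b c d e f ha hb hc hd he hf
    have hg : Differentiable ℂ fun z => G (a z) (b z) (c z) (d z) (e z) (f z) := by
      rw [hG]; fun_prop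
    have hsg : ∀ z, e z + f z + G (a z) (b z) (c z) (d z) (e z) (f z) =
        a z + b z + c z + d z + 1 := fun z => by rw [hG]; ring
    have q : ∀ {u v : ℂ → ℂ}, Differentiable ℂ u → Differentiable ℂ v →
        Differentiable ℂ fun z => 1 + u z - v z := fun hu hv => (hu.const_add 1).sub hv
    have h5 : ∀ {p q r s t : ℂ → ℂ}, Differentiable ℂ p → Differentiable ℂ q →
        Differentiable ℂ r → Differentiable ℂ s → Differentiable ℂ t →
        Differentiable ℂ fun z => (Complex.Gamma (p z))⁻¹ * (Complex.Gamma (q z))⁻¹ *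
          (Complex.Gamma (r z))⁻¹ * (Complex.Gamma (s z))⁻¹ * (Complex.Gamma (t z))⁻¹ :=
      fun hp hq hr hs ht => ((((differentiable_Gamma_inv hp).mul (differentiable_Gamma_inv hq)).mul
        (differentiable_Gamma_inv hr)).mul (differentiable_Gamma_inv hs)).mul
        (differentiable_Gamma_inv ht)
    have r0 := differentiable_regSum ha hb hc hd he hf hg hsg
    have r1 := differentiable_regSum (q ha hf) (q hb hf) (q hc hf) (q hd hf) (hf.const_sub 2)
      (q he hf) (q hg hf) fun z => by linear_combination hsg z
    have r2 := differentiable_regSum (q ha hg) (q hb hg) (q hc hg) (q hd hg) (hg.const_sub 2)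
      (q he hg) (q hf hg) fun z => by linear_combination hsg z
    have r3 := differentiable_regSum ha (q ha he) (q ha hf) (q ha hg) (q ha hb) (q ha hc)
      (q ha hd) fun z => by linear_combination hsg z
    have t0 := ((differentiable_Sn (hf.sub hg)).mul (h5 (hb.const_sub 1) (hc.const_sub 1)
      (hd.const_sub 1) (q ha hf) (q ha hg))).mul r0
    have t1 := ((differentiable_Sn hg).mul (h5 (hf.sub hb) (hf.sub hc) (hf.sub hd) ha
      (q ha hg))).mul r1
    have t2 := ((differentiable_Sn hf).mul (h5 (hg.sub hb) (hg.sub hc) (hg.sub hd) ha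
      (q ha hf))).mul r2
    have t3 := ((((differentiable_Sn hf).mul (differentiable_Sn hg)).mul
      (differentiable_Sn (hf.sub hg))).mul (differentiable_Gamma_inv (he.sub ha))).mul r3
    exact (((t0.sub t1).add t2).const_mul _).sub t3
  · intro a b c d e f ha hb hc hd he hf
    rw [abs_lt] at ha hb hc hd he hf
    have := four_term_ofReal (a := a) (b := b) (c := c) (d := d) (e := e) (f := f)
      (g := a + b + c + d + 1 - e - f) (by linarith) (by linarith) (by linarith) (by linarith)
      (by linarith) (by linarith) (by linarith) (by linarith) (by linarith) (by linarith)
    rw [hG]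
    push_cast at this
    exact sub_eq_zero.mpr this

theorem Sn_mul_identity {b c d e' f g : ℂ} (he : e' = b + c + d + 1 - f - g) :
    -(Sn g * (Sn (f - b) * Sn (f - c) * Sn (f - d))) +
      Sn f * (Sn (g - b) * Sn (g - c) * Sn (g - d)) +
      Sn (f - g) * (Sn b * Sn c * Sn d + Sn e' * Sn f * Sn g) = 0 := by
  rw [he, show b + c + d + 1 - f - g = 1 - (f + g - (b + c + d)) by ring, Sn_one_sub]
  simp only [Sn, mul_add, mul_sub, Complex.sin_sub, Complex.sin_add, Complex.cos_add]
  have hf := Complex.sin_sq_add_cos_sq (Real.pi * f)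
  have hg := Complex.sin_sq_add_cos_sq (Real.pi * g)
  generalize Complex.sin (Real.pi * f) = sf at *
  generalize Complex.cos (Real.pi * f) = cf at *
  generalize Complex.sin (Real.pi * g) = sg at *
  generalize Complex.cos (Real.pi * g) = cg at *
  generalize Complex.sin (Real.pi * b) = sb
  generalize Complex.cos (Real.pi * b) = cb
  generalize Complex.sin (Real.pi * c) = sc
  generalize Complex.cos (Real.pi * c) = cc
  generalize Complex.sin (Real.pi * d) = sd
  generalize Complex.cos (Real.pi * d) = cd
  linear_combination
    (-(sf * sg * sg ^ 2) * (cb * cc * cd) +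
      sf * sg * (sg * cg) * (sb * cc * cd + cb * sc * cd + cb * cc * sd) -
      sf * sg * cg ^ 2 * (sb * sc * cd + sb * cc * sd + cb * sc * sd) +
      (cf * sg - sf * sg * (sg * cg)) * (sb * sc * sd)) * hf +
    (sf * sg * sf ^ 2 * (cb * cc * cd) -
      sf * sg * (sf * cf) * (sb * cc * cd + cb * sc * cd + cb * cc * sd) +
      sf * sg * cf ^ 2 * (sb * sc * cd + sb * cc * sd + cb * sc * sd) +
      (-(sf * cg) + sf * sg * (sf * cf)) * (sb * sc * sd)) * hg

theorem ne_neg_natCast_of_ne_intCast {x : ℂ} (hx : ∀ n : ℤ, x ≠ n) (n : ℕ) : x ≠ -n := by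
  simpa using hx (-n)

theorem pi_mul_Kf {a b c d e f g : ℂ} (ha : ∀ n : ℤ, a ≠ n) (hb : ∀ n : ℤ, b ≠ n)
    (hc : ∀ n : ℤ, c ≠ n) (hd : ∀ n : ℤ, d ≠ n) (he : ∀ n : ℤ, 1 + a - e ≠ n)
    (hf : ∀ n : ℤ, 1 + a - f ≠ n) (hg : ∀ n : ℤ, 1 + a - g ≠ n) :
    Real.pi * ((Complex.Gamma (1 - a))⁻¹ * Kf a b c d e f g) =
      regSum a b c d e f g * ((Complex.Gamma (1 + a - e))⁻¹ * (Complex.Gamma (1 + a - f))⁻¹ *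
        (Complex.Gamma (1 + a - g))⁻¹) +
      regSum a (1 + a - e) (1 + a - f) (1 + a - g) (1 + a - b) (1 + a - c) (1 + a - d) *
        ((Complex.Gamma b)⁻¹ * (Complex.Gamma c)⁻¹ * (Complex.Gamma d)⁻¹) := by
  have key : ∀ {x : ℂ}, (∀ n : ℤ, x ≠ n) → ∀ n : ℕ, x ≠ -n := ne_neg_natCast_of_ne_intCast
  rw [Kf, Fstar_eq_regSum (key ha) (key hb) (key hc) (key hd),
    Fstar_eq_regSum (key ha) (key he) (key hf) (key hg), Sn_eq_Gamma_inv (x := a) rfl]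
  have n1 := Complex.Gamma_ne_zero (key ha)
  have n2 := Complex.Gamma_ne_zero (key hb)
  have n3 := Complex.Gamma_ne_zero (key hc)
  have n4 := Complex.Gamma_ne_zero (key hd)
  have n5 := Complex.Gamma_ne_zero (key he)
  have n6 := Complex.Gamma_ne_zero (key hf)
  have n7 := Complex.Gamma_ne_zero (key hg)
  have n8 : Complex.Gamma (1 - a) ≠ 0 := Complex.Gamma_ne_zero (key fun n h =>
    ha (1 - n) (by push_cast; linear_combination -h))
  have n9 : (Real.pi : ℂ) ≠ 0 := by exact_mod_cast Real.pi_ne_zero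
  field_simp

theorem Sn_mul_Lf {a b c d e : ℂ} (ha : ∀ n : ℤ, a ≠ n) (hb : ∀ n : ℤ, b ≠ n)
    (hc : ∀ n : ℤ, c ≠ n) (hd : ∀ n : ℤ, d ≠ n) (he : ∀ n : ℤ, e ≠ n)
    (hae : ∀ n : ℤ, a - e ≠ n) (hbe : ∀ n : ℤ, b - e ≠ n)
    (hce : ∀ n : ℤ, c - e ≠ n) (hde : ∀ n : ℤ, d - e ≠ n) (f g : ℂ) :
    Sn e * Lf a b c d e f g = regL a b c d e f g := by
  have key : ∀ {x : ℂ}, (∀ n : ℤ, x ≠ n) → ∀ n : ℕ, x ≠ -n := ne_neg_natCast_of_ne_intCast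
  have shift : ∀ {x : ℂ}, (∀ n : ℤ, x - e ≠ n) → ∀ n : ℕ, 1 + x - e ≠ -n := fun h =>
    key fun n hn => h (n - 1) (by push_cast; linear_combination hn)
  rw [Lf, Fstar_eq_regSum (key ha) (key hb) (key hc) (key hd),
    Fstar_eq_regSum (shift hae) (shift hbe) (shift hce) (shift hde), regL]
  have n1 := Complex.Gamma_ne_zero (key ha)
  have n2 := Complex.Gamma_ne_zero (key hb)
  have n3 := Complex.Gamma_ne_zero (key hc)
  have n4 := Complex.Gamma_ne_zero (key hd)
  have n5 := Complex.Gamma_ne_zero (shift hae)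
  have n6 := Complex.Gamma_ne_zero (shift hbe)
  have n7 := Complex.Gamma_ne_zero (shift hce)
  have n8 := Complex.Gamma_ne_zero (shift hde)
  have n9 := Sn_ne_zero he
  field_simp

theorem regSum_swap_lower (a b c d e f g : ℂ) : regSum a b c d e f g = regSum a b c d f e g :=
  tsum_congr fun k => by unfold regTerm; ring

theorem regSum_reverse_lower (a b c d e f g : ℂ) : regSum a b c d e f g = regSum a b c d g f e :=
  tsum_congr fun k => by unfold regTerm; ring

theorem Sn_mul_Lf_reflect {a b c d e f g : ℂ} (hs : e + f + g = a + b + c + d + 1)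
    (ha : ∀ n : ℤ, a ≠ n) (hb : ∀ n : ℤ, b ≠ n)
    (hc : ∀ n : ℤ, c ≠ n) (hd : ∀ n : ℤ, d ≠ n) (he : ∀ n : ℤ, e ≠ n)
    (hae : ∀ n : ℤ, a - e ≠ n) (hbe : ∀ n : ℤ, b - e ≠ n)
    (hce : ∀ n : ℤ, c - e ≠ n) (hde : ∀ n : ℤ, d - e ≠ n) (hcd : ∀ n : ℤ, c - d ≠ n) :
    Sn (f - g) * Lf (1 - a) (1 - b) (1 - c) (1 - d) (2 - e) (2 - f) (2 - g) =
      regSum (1 + a - f) (1 + b - f) (1 + c - f) (1 + d - f) (2 - f) (1 + e - f) (1 + g - f) *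
        ((Complex.Gamma (1 + a - g))⁻¹ * (Complex.Gamma (1 + b - g))⁻¹ *
          (Complex.Gamma (1 + c - g))⁻¹ * (Complex.Gamma (1 + d - g))⁻¹) -
      regSum (1 + a - g) (1 + b - g) (1 + c - g) (1 + d - g) (2 - g) (1 + e - g) (1 + f - g) *
        ((Complex.Gamma (1 + a - f))⁻¹ * (Complex.Gamma (1 + b - f))⁻¹ *
          (Complex.Gamma (1 + c - f))⁻¹ * (Complex.Gamma (1 + d - f))⁻¹) := by
  have hx : ∀ {x : ℂ}, (∀ n : ℤ, x ≠ n) → ∀ n : ℤ, 1 - x ≠ n := fun h n hn =>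
    h (1 - n) (by push_cast; linear_combination -hn)
  have hxe : ∀ {x : ℂ}, (∀ n : ℤ, x - e ≠ n) → ∀ n : ℤ, 1 - x - (2 - e) ≠ n := fun h n hn =>
    h (-1 - n) (by push_cast; linear_combination -hn)
  have he2 : ∀ n : ℤ, 2 - e ≠ n := fun n hn => he (2 - n) (by push_cast; linear_combination -hn)
  have h1 := Sn_mul_Lf (hx ha) (hx hb) (hx hc) (hx hd) he2 (hxe hae) (hxe hbe) (hxe hce) (hxe hde)
    (2 - f) (2 - g)
  have h2 := regL_reflect (a := 1 - a) (b := 1 - b) (c := 1 - c) (d := 1 - d) (e := 2 - e)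
    (f := 2 - f) (g := 2 - g) (by linear_combination -hs)
    fun n hn => hcd (-n) (by push_cast; linear_combination -hn)
  have hsub : ∀ x : ℂ, 2 - g - (1 - x) = 1 + x - g := fun x => by ring
  have hadd : ∀ x : ℂ, 1 + (1 + x - g) - (1 + f - g) = 1 + x - f := fun x => by ring
  rw [show 1 + (2 - g) - (2 - f) = 1 + (f - g) by ring, Sn_add_one,
    show 1 + (2 - g) - (2 - e) = 1 + e - g by ring, hsub, hsub, hsub, hsub,
    show 1 + (f - g) = 1 + f - g by ring, regL.eq_1 (1 + a - g), hadd, hadd, hadd, hadd, hadd,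
    show 2 - (1 + f - g) = 1 + g - f by ring,
    show 1 + (2 - g) - (1 + f - g) = 2 - f by ring,
    regSum_reverse_lower _ _ _ _ (1 + f - g), regSum_reverse_lower _ _ _ _ (1 + g - f)] at h2
  refine mul_left_cancel₀ (Sn_ne_zero he2) ?_
  linear_combination Sn (f - g) * h1 - h2

theorem orbit2_KLL_relation (a b c d e f g : ℂ)
    (hsaal : e + f + g = a + b + c + d + 1)
    (hint : ∀ i : Fin 7, ∀ n : ℤ, ![a, b, c, d, e, f, g] i ≠ (n : ℂ))
    (hdiff : ∀ i j : Fin 7, i ≠ j → ∀ n : ℤ,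
      ![a, b, c, d, e, f, g] i - ![a, b, c, d, e, f, g] j ≠ (n : ℂ)) :
    Sn g * Af (1 + a - f) (1 + b - f) (1 + c - f) (1 + d - f) *
        Af (1 - a) (e - a) (f - a) (g - a) * Kf a b c d e f g +
      Sn (f - a) * Af a b c d * Af (g - a) (g - b) (g - c) (g - d) *
        Lf (1 - a) (1 - b) (1 - c) (1 - d) (2 - e) (2 - f) (2 - g) -
      B4 a b c d e f g * Lf a b c d f e g = 0 := by
  have ha : ∀ n : ℤ, a ≠ n := hint 0
  have hb : ∀ n : ℤ, b ≠ n := hint 1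
  have hc : ∀ n : ℤ, c ≠ n := hint 2
  have hd : ∀ n : ℤ, d ≠ n := hint 3
  have he : ∀ n : ℤ, e ≠ n := hint 4
  have hf : ∀ n : ℤ, f ≠ n := hint 5
  have shift : ∀ {x : ℂ}, (∀ n : ℤ, a - x ≠ n) → ∀ n : ℤ, 1 + a - x ≠ n := fun h n hn =>
    h (n - 1) (by push_cast; linear_combination hn)
  have hK := pi_mul_Kf (e := e) (f := f) ha hb hc hd (g := g)
    (shift (hdiff 0 4 (by decide))) (shift (hdiff 0 5 (by decide))) (shift (hdiff 0 6 (by decide)))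
  have hL := Sn_mul_Lf_reflect hsaal ha hb hc hd he (hdiff 0 4 (by decide))
    (hdiff 1 4 (by decide)) (hdiff 2 4 (by decide)) (hdiff 3 4 (by decide)) (hdiff 2 3 (by decide))
  have hL' := Sn_mul_Lf ha hb hc hd hf (hdiff 0 5 (by decide)) (hdiff 1 5 (by decide))
    (hdiff 2 5 (by decide)) (hdiff 3 5 (by decide)) e g
  rw [regL, regSum_swap_lower] at hL'
  have h4 := regSum_four_term hsaal
  have hT := Sn_mul_identity (b := b) (c := c) (d := d) (e' := e - a) (f := f) (g := g)
    (by linear_combination hsaal)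
  have hSf := Sn_ne_zero hf
  have hSfg : Sn (f - g) ≠ 0 := Sn_ne_zero (hdiff 5 6 (by decide))
  have hpi : (Real.pi : ℂ) ≠ 0 := by exact_mod_cast Real.pi_ne_zero
  have hB : (Real.pi : ℂ) ^ 4 * B4 a b c d e f g =
      Sn (f - a) * Sn (g - a) * (Sn b * Sn c * Sn d + Sn (e - a) * Sn f * Sn g) := by
    rw [B4, mul_div_cancel₀ _ (pow_ne_zero 4 hpi)]
  have key : ∀ {x : ℂ}, Sn (f - x) = Real.pi * (Complex.Gamma (f - x))⁻¹ *
      (Complex.Gamma (1 + x - f))⁻¹ := Sn_eq_Gamma_inv (by ring)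
  have key' : ∀ {x : ℂ}, Sn (g - x) = Real.pi * (Complex.Gamma (g - x))⁻¹ *
      (Complex.Gamma (1 + x - g))⁻¹ := Sn_eq_Gamma_inv (by ring)
  have hea : Sn (e - a) = Real.pi * (Complex.Gamma (e - a))⁻¹ *
      (Complex.Gamma (1 + a - e))⁻¹ := Sn_eq_Gamma_inv (by ring)
  rw [@key b, @key c, @key d, @key' b, @key' c, @key' d] at hT
  rw [@key a, @key' a] at hB
  rw [hea, Sn_eq_Gamma_inv (x := b) rfl, Sn_eq_Gamma_inv (x := c) rfl,
    Sn_eq_Gamma_inv (x := d) rfl] at hB hT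
  rw [@key a]
  simp only [Af, one_div, mul_inv]
  generalize B4 a b c d e f g = B at *
  generalize Kf a b c d e f g = K at *
  generalize Lf a b c d f e g = L at *
  generalize Lf _ _ _ _ _ _ _ = L' at *
  generalize regSum a b c d e f g = R0 at *
  generalize regSum a _ _ _ _ _ _ = Ra at *
  generalize regSum (1 + a - f) _ _ _ _ _ _ = Rf at *
  generalize regSum (1 + a - g) _ _ _ _ _ _ = Rg at *
  generalize Sn (f - g) = Sfg at *
  generalize Sn f = Sf at *
  generalize Sn g = Sg at *
  clear key key' hea shift
  generalize (Complex.Gamma a)⁻¹ = ra at *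
  generalize (Complex.Gamma b)⁻¹ = rb at *
  generalize (Complex.Gamma c)⁻¹ = rc at *
  generalize (Complex.Gamma d)⁻¹ = rd at *
  generalize (Complex.Gamma (1 - a))⁻¹ = ma at *
  generalize (Complex.Gamma (1 - b))⁻¹ = mb at *
  generalize (Complex.Gamma (1 - c))⁻¹ = mc at *
  generalize (Complex.Gamma (1 - d))⁻¹ = md at *
  generalize (Complex.Gamma (e - a))⁻¹ = rea at *
  generalize (Complex.Gamma (1 + a - e))⁻¹ = rae at *
  generalize (Complex.Gamma (f - a))⁻¹ = rfa at *
  generalize (Complex.Gamma (f - b))⁻¹ = rfb at *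
  generalize (Complex.Gamma (f - c))⁻¹ = rfc at *
  generalize (Complex.Gamma (f - d))⁻¹ = rfd at *
  generalize (Complex.Gamma (g - a))⁻¹ = rga at *
  generalize (Complex.Gamma (g - b))⁻¹ = rgb at *
  generalize (Complex.Gamma (g - c))⁻¹ = rgc at *
  generalize (Complex.Gamma (g - d))⁻¹ = rgd at *
  generalize (Complex.Gamma (1 + a - f))⁻¹ = raf at *
  generalize (Complex.Gamma (1 + b - f))⁻¹ = rbf at *
  generalize (Complex.Gamma (1 + c - f))⁻¹ = rcf at *
  generalize (Complex.Gamma (1 + d - f))⁻¹ = rdf at *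
  generalize (Complex.Gamma (1 + a - g))⁻¹ = rag at *
  generalize (Complex.Gamma (1 + b - g))⁻¹ = rbg at *
  generalize (Complex.Gamma (1 + c - g))⁻¹ = rcg at *
  generalize (Complex.Gamma (1 + d - g))⁻¹ = rdg at *
  refine mul_left_cancel₀ (mul_ne_zero (mul_ne_zero (pow_ne_zero 4 hpi) hSf) hSfg) ?_
  generalize (Real.pi : ℂ) = p at *
  linear_combination
    p ^ 3 * Sf * Sfg * Sg * (raf * rbf * rcf * rdf) * (rea * rfa * rga) * hK +
    p ^ 5 * Sf * (rfa * raf) * (ra * rb * rc * rd) * (rga * rgb * rgc * rgd) * hL -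
    p ^ 4 * Sfg * B * hL' -
    Sfg * (R0 * (raf * rbf * rcf * rdf) - Rf * (ra * rb * rc * rd)) * hB -
    p ^ 3 * (raf * rbf * rcf * rdf) * (rfa * rga * rb * rc * rd) * h4 +
    p ^ 2 * (ra * rb * rc * rd) * Rf * (rfa * raf * rga * rag) * hT
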